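/- In the resolvent-sequence setting, if (H1) holds, then for every ε with 0 < ε < β/12: ∫_{3ε}^{β−3ε} |v³ₙ′|² dx → 0 and λₙ² ∫_{4ε}^{β−4ε} |v³ₙ|² dx → 0 as n → ∞. -/

import Mathlib

open Set Filter MeasureTheory

noncomputable section

/-- The resolvent-sequence setting for the locally damped Bresse system with
parameter `ℓ`: a sequence of nonzero frequencies `lam n` with `|lam n| → ∞`,
solutions `Uₙ = (v1,…,v6)` and right-hand sides `Fₙ = (f1,…,f6)` of the resolvent
equations `(lam n)^ℓ (i (lam n) I − 𝒜) Uₙ = Fₙ`, with `‖Uₙ‖_H = 1` and `‖Fₙ‖_H → 0`. -/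
structure BresseSetting (ρ₁ ρ₂ k₁ k₂ k₃ l L β a₀ : ℝ) (ℓ : ℕ) where
  lam : ℕ → ℝ
  v1 : ℕ → ℝ → ℂ
  v2 : ℕ → ℝ → ℂ
  v3 : ℕ → ℝ → ℂ
  v4 : ℕ → ℝ → ℂ
  v5 : ℕ → ℝ → ℂ
  v6 : ℕ → ℝ → ℂ
  f1 : ℕ → ℝ → ℂ
  f2 : ℕ → ℝ → ℂ
  f3 : ℕ → ℝ → ℂ
  f4 : ℕ → ℝ → ℂ
  f5 : ℕ → ℝ → ℂ
  f6 : ℕ → ℝ → ℂ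
  lam_ne : ∀ n, lam n ≠ 0
  lam_tendsto : Tendsto (fun n => |lam n|) atTop atTop
  reg_v1 : ∀ n, ContDiffOn ℝ 2 (v1 n) (Icc 0 L)
  reg_v3 : ∀ n, ContDiffOn ℝ 2 (v3 n) (Icc 0 L)
  reg_v5 : ∀ n, ContDiffOn ℝ 1 (v5 n) (Icc 0 L)
  reg_v5_left : ∀ n, ContDiffOn ℝ 2 (v5 n) (Icc 0 β)
  reg_v5_right : ∀ n, ContDiffOn ℝ 2 (v5 n) (Icc β L)
  reg_v2 : ∀ n, ContDiffOn ℝ 1 (v2 n) (Icc 0 L)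
  reg_v4 : ∀ n, ContDiffOn ℝ 1 (v4 n) (Icc 0 L)
  reg_v6 : ∀ n, ContDiffOn ℝ 1 (v6 n) (Icc 0 L)
  reg_f1 : ∀ n, ContDiffOn ℝ 1 (f1 n) (Icc 0 L)
  reg_f3 : ∀ n, ContDiffOn ℝ 1 (f3 n) (Icc 0 L)
  reg_f5 : ∀ n, ContDiffOn ℝ 1 (f5 n) (Icc 0 L)
  reg_f2 : ∀ n, ContinuousOn (f2 n) (Icc 0 L)
  reg_f4 : ∀ n, ContinuousOn (f4 n) (Icc 0 L)
  reg_f6 : ∀ n, ContinuousOn (f6 n) (Icc 0 L)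
  bc_zero : ∀ n, v1 n 0 = 0 ∧ v2 n 0 = 0 ∧ v3 n 0 = 0 ∧ v4 n 0 = 0 ∧ v5 n 0 = 0 ∧
      v6 n 0 = 0 ∧ f1 n 0 = 0 ∧ f3 n 0 = 0 ∧ f5 n 0 = 0
  bc_L : ∀ n, v1 n L = 0 ∧ v2 n L = 0 ∧ v3 n L = 0 ∧ v4 n L = 0 ∧ v5 n L = 0 ∧
      v6 n L = 0 ∧ f1 n L = 0 ∧ f3 n L = 0 ∧ f5 n L = 0
  eq1 : ∀ n, ∀ x ∈ Ioo (0 : ℝ) β ∪ Ioo β L,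
      Complex.I * (lam n : ℂ) * v1 n x - v2 n x = (lam n : ℂ) ^ (-(ℓ : ℤ)) * f1 n x
  eq2 : ∀ n, ∀ x ∈ Ioo (0 : ℝ) β ∪ Ioo β L,
      Complex.I * (lam n : ℂ) * (ρ₁ : ℂ) * v2 n x
        - (k₁ : ℂ) * deriv (fun y => deriv (v1 n) y + v3 n y + (l : ℂ) * v5 n y) x
        - (l : ℂ) * (k₃ : ℂ) * (deriv (v5 n) x - (l : ℂ) * v1 n x)
        = (ρ₁ : ℂ) * (lam n : ℂ) ^ (-(ℓ : ℤ)) * f2 n x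
  eq3 : ∀ n, ∀ x ∈ Ioo (0 : ℝ) β ∪ Ioo β L,
      Complex.I * (lam n : ℂ) * v3 n x - v4 n x = (lam n : ℂ) ^ (-(ℓ : ℤ)) * f3 n x
  eq4 : ∀ n, ∀ x ∈ Ioo (0 : ℝ) β ∪ Ioo β L,
      Complex.I * (lam n : ℂ) * (ρ₂ : ℂ) * v4 n x
        - (k₂ : ℂ) * deriv (deriv (v3 n)) x
        + (k₁ : ℂ) * (deriv (v1 n) x + v3 n x + (l : ℂ) * v5 n x)
        = (ρ₂ : ℂ) * (lam n : ℂ) ^ (-(ℓ : ℤ)) * f4 n x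
  eq5 : ∀ n, ∀ x ∈ Ioo (0 : ℝ) β ∪ Ioo β L,
      Complex.I * (lam n : ℂ) * v5 n x - v6 n x = (lam n : ℂ) ^ (-(ℓ : ℤ)) * f5 n x
  eq6 : ∀ n, ∀ x ∈ Ioo (0 : ℝ) β ∪ Ioo β L,
      Complex.I * (lam n : ℂ) * (ρ₁ : ℂ) * v6 n x
        - (k₃ : ℂ) * deriv (fun y => deriv (v5 n) y - (l : ℂ) * v1 n y) x
        + (l : ℂ) * (k₁ : ℂ) * (deriv (v1 n) x + v3 n x + (l : ℂ) * v5 n x)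
        + (if x < β then (a₀ : ℂ) else 0) * v6 n x
        = (ρ₁ : ℂ) * (lam n : ℂ) ^ (-(ℓ : ℤ)) * f6 n x
  normU : ∀ n, (∫ x in (0 : ℝ)..L,
      (k₁ * ‖deriv (v1 n) x + v3 n x + (l : ℂ) * v5 n x‖ ^ 2 + ρ₁ * ‖v2 n x‖ ^ 2
        + k₂ * ‖deriv (v3 n) x‖ ^ 2 + ρ₂ * ‖v4 n x‖ ^ 2
        + k₃ * ‖deriv (v5 n) x - (l : ℂ) * v1 n x‖ ^ 2 + ρ₁ * ‖v6 n x‖ ^ 2)) = 1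
  normF : Tendsto (fun n => ∫ x in (0 : ℝ)..L,
      (k₁ * ‖deriv (f1 n) x + f3 n x + (l : ℂ) * f5 n x‖ ^ 2 + ρ₁ * ‖f2 n x‖ ^ 2
        + k₂ * ‖deriv (f3 n) x‖ ^ 2 + ρ₂ * ‖f4 n x‖ ^ 2
        + k₃ * ‖deriv (f5 n) x - (l : ℂ) * f1 n x‖ ^ 2 + ρ₁ * ‖f6 n x‖ ^ 2))
      atTop (nhds 0)

/-- Sequence bounded in L² on [c,d]. -/
def BrBd (c d : ℝ) (φ : ℕ → ℝ → ℂ) : Prop :=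
  (∀ n, ContinuousOn (φ n) (Icc c d)) ∧ ∃ M : ℝ, ∀ n, ∫ x in c..d, ‖φ n x‖ ^ 2 ≤ M

/-- Sequence tending to zero in L² on [c,d]. -/
def BrNul (c d : ℝ) (φ : ℕ → ℝ → ℂ) : Prop :=
  (∀ n, ContinuousOn (φ n) (Icc c d)) ∧
    Tendsto (fun n => ∫ x in c..d, ‖φ n x‖ ^ 2) atTop (nhds 0)

/-- Sequence with integral tending to zero on [c,d]. -/
def BrTN (c d : ℝ) (φ : ℕ → ℝ → ℂ) : Prop :=
  (∀ n, ContinuousOn (φ n) (Icc c d)) ∧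
    Tendsto (fun n => ∫ x in c..d, φ n x) atTop (nhds 0)

lemma br_ii {E : Type*} [NormedAddCommGroup E] {c d : ℝ} (h : c ≤ d) {f : ℝ → E}
    (hf : ContinuousOn f (Icc c d)) :
    IntervalIntegrable f volume c d :=
  ContinuousOn.intervalIntegrable_of_Icc h hf

lemma br_sqi {c d : ℝ} (h : c ≤ d) {f : ℝ → ℂ} (hf : ContinuousOn f (Icc c d)) :
    IntervalIntegrable (fun x => ‖f x‖ ^ 2) volume c d :=
  br_ii h (hf.norm.pow 2)

lemma br_sq_nonneg {c d : ℝ} (h : c ≤ d) (f : ℝ → ℂ) : 0 ≤ ∫ x in c..d, ‖f x‖ ^ 2 :=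
  intervalIntegral.integral_nonneg h (fun x _ => by positivity)

lemma BrNul.bd {c d : ℝ} {φ : ℕ → ℝ → ℂ} (h : BrNul c d φ) : BrBd c d φ := by
  refine ⟨h.1, ?_⟩
  obtain ⟨M, hM⟩ := h.2.bddAbove_range
  exact ⟨M, fun n => hM ⟨n, rfl⟩⟩

lemma BrNul.dom2 {c d : ℝ} (hcd : c ≤ d) {φ χ ω : ℕ → ℝ → ℂ} (hχ : BrNul c d χ)
    (hω : BrNul c d ω)
    (hφ : ∀ n, ContinuousOn (φ n) (Icc c d)) (C : ℝ)
    (hle : ∀ n, ∀ x ∈ Icc c d, ‖φ n x‖ ^ 2 ≤ C * (‖χ n x‖ ^ 2 + ‖ω n x‖ ^ 2)) :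
    BrNul c d φ := by
  refine ⟨hφ, ?_⟩
  have h0 : Tendsto (fun n => C * ((∫ x in c..d, ‖χ n x‖ ^ 2) + ∫ x in c..d, ‖ω n x‖ ^ 2)) atTop
      (nhds 0) := by
    simpa using (hχ.2.add hω.2).const_mul C
  refine squeeze_zero (fun n => br_sq_nonneg hcd _) (fun n => ?_) h0
  have h1 := br_sqi hcd (hχ.1 n)
  have h2 := br_sqi hcd (hω.1 n)
  rw [← intervalIntegral.integral_add h1 h2, ← intervalIntegral.integral_const_mul]
  exact intervalIntegral.integral_mono_on hcd (br_sqi hcd (hφ n))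
    ((h1.add h2).const_mul C) (hle n)

lemma BrBd.dom2 {c d : ℝ} (hcd : c ≤ d) {φ χ ω : ℕ → ℝ → ℂ} (hχ : BrBd c d χ)
    (hω : BrBd c d ω)
    (hφ : ∀ n, ContinuousOn (φ n) (Icc c d)) (C : ℝ) (hC : 0 ≤ C)
    (hle : ∀ n, ∀ x ∈ Icc c d, ‖φ n x‖ ^ 2 ≤ C * (‖χ n x‖ ^ 2 + ‖ω n x‖ ^ 2)) :
    BrBd c d φ := by
  obtain ⟨M, hM⟩ := hχ.2
  obtain ⟨N, hN⟩ := hω.2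
  refine ⟨hφ, C * (M + N), fun n => ?_⟩
  have h1 := br_sqi hcd (hχ.1 n)
  have h2 := br_sqi hcd (hω.1 n)
  have := intervalIntegral.integral_mono_on hcd (br_sqi hcd (hφ n))
    ((h1.add h2).const_mul C) (hle n)
  refine this.trans ?_
  rw [intervalIntegral.integral_const_mul, intervalIntegral.integral_add h1 h2]
  exact mul_le_mul_of_nonneg_left (add_le_add (hM n) (hN n)) hC

lemma br_norm_add_sq (a b : ℂ) : ‖a + b‖ ^ 2 ≤ 2 * (‖a‖ ^ 2 + ‖b‖ ^ 2) := by
  have := norm_add_le a b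
  have h0 := norm_nonneg (a + b)
  nlinarith [sq_nonneg (‖a‖ - ‖b‖)]

lemma BrNul.add {c d : ℝ} (hcd : c ≤ d) {φ χ : ℕ → ℝ → ℂ} (hφ : BrNul c d φ)
    (hχ : BrNul c d χ) : BrNul c d (fun n x => φ n x + χ n x) :=
  BrNul.dom2 hcd hφ hχ (fun n => (hφ.1 n).add (hχ.1 n)) 2 (fun n x _ => br_norm_add_sq _ _)

lemma BrBd.add {c d : ℝ} (hcd : c ≤ d) {φ χ : ℕ → ℝ → ℂ} (hφ : BrBd c d φ)
    (hχ : BrBd c d χ) : BrBd c d (fun n x => φ n x + χ n x) :=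
  BrBd.dom2 hcd hφ hχ (fun n => (hφ.1 n).add (hχ.1 n)) 2 (by norm_num)
    (fun n x _ => br_norm_add_sq _ _)

/-- Multiplication by uniformly bounded weights. -/
lemma BrNul.wmul {c d : ℝ} (hcd : c ≤ d) {φ g : ℕ → ℝ → ℂ} (hφ : BrNul c d φ)
    (hg : ∀ n, ContinuousOn (g n) (Icc c d)) (C : ℝ) (hC : ∀ n, ∀ x ∈ Icc c d, ‖g n x‖ ≤ C) :
    BrNul c d (fun n x => g n x * φ n x) := by
  refine BrNul.dom2 hcd hφ hφ (fun n => (hg n).mul (hφ.1 n)) (C ^ 2) (fun n x hx => ?_)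
  rw [norm_mul, mul_pow]
  have : ‖g n x‖ ^ 2 ≤ C ^ 2 := pow_le_pow_left₀ (norm_nonneg _) (hC n x hx) 2
  nlinarith [sq_nonneg ‖φ n x‖, sq_nonneg C, mul_nonneg (sq_nonneg ‖φ n x‖) (sq_nonneg C)]

lemma BrBd.wmul {c d : ℝ} (hcd : c ≤ d) {φ g : ℕ → ℝ → ℂ} (hφ : BrBd c d φ)
    (hg : ∀ n, ContinuousOn (g n) (Icc c d)) (C : ℝ) (hC : ∀ n, ∀ x ∈ Icc c d, ‖g n x‖ ≤ C) :
    BrBd c d (fun n x => g n x * φ n x) := by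
  refine BrBd.dom2 hcd hφ hφ (fun n => (hg n).mul (hφ.1 n)) (C ^ 2) (sq_nonneg C) (fun n x hx => ?_)
  rw [norm_mul, mul_pow]
  have : ‖g n x‖ ^ 2 ≤ C ^ 2 := pow_le_pow_left₀ (norm_nonneg _) (hC n x hx) 2
  nlinarith [sq_nonneg ‖φ n x‖, sq_nonneg C, mul_nonneg (sq_nonneg ‖φ n x‖) (sq_nonneg C)]

lemma BrNul.cmul {c d : ℝ} (hcd : c ≤ d) {φ : ℕ → ℝ → ℂ} (hφ : BrNul c d φ) (z : ℂ) :
    BrNul c d (fun n x => z * φ n x) :=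
  hφ.wmul hcd (g := fun _ _ => z) (fun _ => continuousOn_const) ‖z‖ (fun _ _ _ => le_rfl)

lemma BrBd.cmul {c d : ℝ} (hcd : c ≤ d) {φ : ℕ → ℝ → ℂ} (hφ : BrBd c d φ) (z : ℂ) :
    BrBd c d (fun n x => z * φ n x) :=
  hφ.wmul hcd (g := fun _ _ => z) (fun _ => continuousOn_const) ‖z‖ (fun _ _ _ => le_rfl)

lemma BrNul.hmul {c d : ℝ} (hcd : c ≤ d) {φ : ℕ → ℝ → ℂ} (hφ : BrNul c d φ) {h : ℝ → ℂ}
    (hh : Continuous h) : BrNul c d (fun n x => h x * φ n x) := by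
  obtain ⟨C, hC⟩ := isCompact_Icc.exists_bound_of_continuousOn (s := Icc c d) hh.continuousOn
  exact hφ.wmul hcd (g := fun _ x => h x) (fun _ => hh.continuousOn) C (fun _ => hC)

lemma BrNul.star {c d : ℝ} {φ : ℕ → ℝ → ℂ} (hφ : BrNul c d φ) :
    BrNul c d (fun n x => star (φ n x)) :=
  ⟨fun n => (hφ.1 n).star, by simpa using hφ.2⟩

lemma BrBd.star {c d : ℝ} {φ : ℕ → ℝ → ℂ} (hφ : BrBd c d φ) :
    BrBd c d (fun n x => star (φ n x)) :=
  ⟨fun n => (hφ.1 n).star, by simpa using hφ.2⟩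

lemma BrNul.congr {c d : ℝ} (hcd : c ≤ d) {φ χ : ℕ → ℝ → ℂ} (hφ : BrNul c d φ)
    (h : ∀ n, ∀ x ∈ Icc c d, χ n x = φ n x) : BrNul c d χ :=
  BrNul.dom2 hcd hφ hφ (fun n => (hφ.1 n).congr (h n)) 1 (fun n x hx => by
    rw [h n x hx]; nlinarith [sq_nonneg ‖φ n x‖])

lemma BrBd.congr {c d : ℝ} (hcd : c ≤ d) {φ χ : ℕ → ℝ → ℂ} (hφ : BrBd c d φ)
    (h : ∀ n, ∀ x ∈ Icc c d, χ n x = φ n x) : BrBd c d χ :=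
  BrBd.dom2 hcd hφ hφ (fun n => (hφ.1 n).congr (h n)) 1 (by norm_num) (fun n x hx => by
    rw [h n x hx]; nlinarith [sq_nonneg ‖φ n x‖])

lemma BrTN.add {c d : ℝ} (hcd : c ≤ d) {φ χ : ℕ → ℝ → ℂ} (hφ : BrTN c d φ)
    (hχ : BrTN c d χ) : BrTN c d (fun n x => φ n x + χ n x) := by
  refine ⟨fun n => (hφ.1 n).add (hχ.1 n), ?_⟩
  have := hφ.2.add hχ.2
  rw [add_zero] at this
  refine this.congr (fun n => ?_)
  rw [intervalIntegral.integral_add (br_ii hcd (hφ.1 n)) (br_ii hcd (hχ.1 n))]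

lemma BrTN.cmul {c d : ℝ} {φ : ℕ → ℝ → ℂ} (hφ : BrTN c d φ) (z : ℂ) :
    BrTN c d (fun n x => z * φ n x) := by
  refine ⟨fun n => continuousOn_const.mul (hφ.1 n), ?_⟩
  have := hφ.2.const_mul z
  rw [mul_zero] at this
  refine this.congr (fun n => ?_)
  rw [intervalIntegral.integral_const_mul]

lemma BrNul.mul {c d : ℝ} (hcd : c ≤ d) {φ χ : ℕ → ℝ → ℂ} (hφ : BrNul c d φ)
    (hχ : BrBd c d χ) : BrTN c d (fun n x => φ n x * χ n x) := by
  refine ⟨fun n => (hφ.1 n).mul (hχ.1 n), ?_⟩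
  obtain ⟨M, hM⟩ := hχ.2
  rw [Metric.tendsto_nhds]
  intro e he
  have hM0 : 0 ≤ M := (br_sq_nonneg hcd _).trans (hM 0)
  set t : ℝ := e / (M + 1) with ht
  have ht0 : 0 < t := by positivity
  have h1 : ∀ᶠ n in atTop, ∫ x in c..d, ‖φ n x‖ ^ 2 < t * e :=
    hφ.2.eventually_lt_const (by positivity)
  filter_upwards [h1] with n hn
  rw [dist_zero_right]
  have i1 := br_sqi hcd (hφ.1 n)
  have i2 := br_sqi hcd (hχ.1 n)
  have i3 := br_ii hcd ((hφ.1 n).mul (hχ.1 n))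
  have h3 : ‖∫ x in c..d, φ n x * χ n x‖ ≤ ∫ x in c..d, ‖φ n x * χ n x‖ :=
    intervalIntegral.norm_integral_le_integral_norm hcd
  have h4 : ∫ x in c..d, ‖φ n x * χ n x‖ ≤
      ∫ x in c..d, ((1 / (2 * t)) * ‖φ n x‖ ^ 2 + (t / 2) * ‖χ n x‖ ^ 2) := by
    refine intervalIntegral.integral_mono_on hcd i3.norm ((i1.const_mul _).add (i2.const_mul _)) ?_
    intro x _
    rw [norm_mul]
    have : (1 / (2 * t)) * ‖φ n x‖ ^ 2 + (t / 2) * ‖χ n x‖ ^ 2 - ‖φ n x‖ * ‖χ n x‖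
      = (1 / (2 * t)) * (‖φ n x‖ - t * ‖χ n x‖) ^ 2 := by field_simp; ring
    have h5 : 0 ≤ (1 / (2 * t)) * (‖φ n x‖ - t * ‖χ n x‖) ^ 2 := by positivity
    linarith
  rw [intervalIntegral.integral_add (i1.const_mul _) (i2.const_mul _),
    intervalIntegral.integral_const_mul, intervalIntegral.integral_const_mul] at h4
  have h6 : (1 / (2 * t)) * (∫ x in c..d, ‖φ n x‖ ^ 2) < e / 2 := by
    calc _ < (1 / (2 * t)) * (t * e) := by gcongr
      _ = e / 2 := by field_simp
  have h7 : (t / 2) * (∫ x in c..d, ‖χ n x‖ ^ 2) ≤ e / 2 := by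
    calc _ ≤ (t / 2) * M := by gcongr; exact hM n
      _ ≤ (t / 2) * (M + 1) := by gcongr; linarith
      _ = e / 2 := by rw [ht]; field_simp
  linarith

lemma BrBd.small {c d : ℝ} (hcd : c ≤ d) {lam : ℕ → ℝ}
    (hlt : Tendsto (fun n => |lam n|) atTop atTop) (hne : ∀ n, lam n ≠ 0) {φ : ℕ → ℝ → ℂ}
    (hφ : BrBd c d (fun n x => (lam n : ℂ) * φ n x)) : BrNul c d φ := by
  have hcont : ∀ n, ContinuousOn (φ n) (Icc c d) := fun n => by
    have := (continuousOn_const (c := ((lam n : ℂ))⁻¹)).mul (hφ.1 n)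
    refine this.congr (fun x _ => ?_)
    have : (lam n : ℂ) ≠ 0 := by exact_mod_cast hne n
    simp [this]
  refine ⟨hcont, ?_⟩
  obtain ⟨M, hM⟩ := hφ.2
  have h0 : Tendsto (fun n => (|lam n|⁻¹) ^ 2 * M) atTop (nhds 0) := by
    simpa using ((tendsto_inv_atTop_zero.comp hlt).pow 2).mul_const M
  refine squeeze_zero (fun n => br_sq_nonneg hcd _) (fun n => ?_) h0
  have h2 := hM n
  have hl : 0 < |lam n| := abs_pos.2 (hne n)
  have : ∫ x in c..d, ‖(lam n : ℂ) * φ n x‖ ^ 2 = |lam n| ^ 2 * ∫ x in c..d, ‖φ n x‖ ^ 2 := by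
    rw [← intervalIntegral.integral_const_mul]
    congr 1; ext x
    rw [norm_mul, mul_pow]; simp
  rw [this] at h2
  calc _ = (|lam n|⁻¹) ^ 2 * (|lam n| ^ 2 * ∫ x in c..d, ‖φ n x‖ ^ 2) := by field_simp
    _ ≤ _ := by gcongr

/-- cutoff -/
def brh (c d : ℝ) (x : ℝ) : ℂ := ((x : ℂ) - c) * (d - x)
def brh' (c d : ℝ) (x : ℝ) : ℂ := (c : ℂ) + d - 2 * x

lemma brh_deriv (c d x : ℝ) : HasDerivAt (brh c d) (brh' c d x) x := by
  have h := (HasDerivAt.ofReal_comp (hasDerivAt_id x))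
  have := (h.sub_const (c : ℂ)).mul (h.const_sub (d : ℂ))
  refine this.congr_deriv ?_
  simp [brh']; ring

lemma brh_cont (c d : ℝ) : Continuous (brh c d) := by unfold brh; fun_prop
lemma brh'_cont (c d : ℝ) : Continuous (brh' c d) := by unfold brh'; fun_prop

lemma br_ftc {c d : ℝ} (hcd : c ≤ d) {φ X : ℝ → ℂ} (hX : ContinuousOn X (Icc c d))
    (hd : ∀ x ∈ Icc c d, HasDerivAt φ (X x) x) (h0 : φ c = 0) (h1 : φ d = 0) :
    ∫ x in c..d, X x = 0 := by
  rw [intervalIntegral.integral_eq_sub_of_hasDerivAt (f := φ) (by rwa [uIcc_of_le hcd])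
    (br_ii hcd hX), h0, h1, sub_zero]

/-- removing the cutoff -/
lemma br_cut {c d c' d' : ℝ} (h1 : c < c') (h2 : c' < d') (h3 : d' < d) {q : ℕ → ℝ → ℂ}
    (hT : BrTN c d (fun n x => brh c d x * (q n x * star (q n x))))
    (hq : ∀ n, ContinuousOn (q n) (Icc c d)) : BrNul c' d' q := by
  have hcd : c ≤ d := by linarith
  refine ⟨fun n => (hq n).mono (Icc_subset_Icc h1.le h3.le), ?_⟩
  have e1 : ∀ n, ∫ x in c..d, brh c d x * (q n x * star (q n x)) =
      ((∫ x in c..d, (x - c) * (d - x) * ‖q n x‖ ^ 2 : ℝ) : ℂ) := by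
    intro n
    rw [← intervalIntegral.integral_ofReal]
    congr 1; ext x
    have : q n x * star (q n x) = ((‖q n x‖ ^ 2 : ℝ) : ℂ) := by
      have := Complex.mul_conj (q n x)
      rw [Complex.normSq_eq_norm_sq] at this
      exact this
    rw [this]; simp [brh]
  have h4 := hT.2
  simp only [e1] at h4
  have h5 : Tendsto (fun n => ∫ x in c..d, (x - c) * (d - x) * ‖q n x‖ ^ 2) atTop (nhds 0) := by
    have := (Complex.continuous_re.tendsto 0).comp h4
    simpa [Function.comp_def] using this
  set m := (c' - c) * (d - d') with hm
  have hm0 : 0 < m := mul_pos (by linarith) (by linarith)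
  have h6 := h5.const_mul m⁻¹
  rw [mul_zero] at h6
  refine squeeze_zero (fun n => br_sq_nonneg h2.le _) (fun n => ?_) h6
  have hc : ContinuousOn (fun x => (x - c) * (d - x) * ‖q n x‖ ^ 2) (Icc c d) := by
    have := (hq n).norm.pow 2
    fun_prop
  have h7 : ∫ x in c'..d', m * ‖q n x‖ ^ 2 ≤ ∫ x in c'..d', (x - c) * (d - x) * ‖q n x‖ ^ 2 := by
    refine intervalIntegral.integral_mono_on h2.le 
      ((br_sqi h2.le ((hq n).mono (Icc_subset_Icc h1.le h3.le))).const_mul m) (br_ii h2.le ?_) ?_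
    · exact hc.mono (Icc_subset_Icc h1.le h3.le)
    · intro x hx
      gcongr
      exact mul_le_mul (by linarith [hx.1]) (by linarith [hx.2]) (by linarith) (by linarith [hx.1])
  have h8 : ∫ x in c'..d', (x - c) * (d - x) * ‖q n x‖ ^ 2 ≤
      ∫ x in c..d, (x - c) * (d - x) * ‖q n x‖ ^ 2 := by
    refine intervalIntegral.integral_mono_interval h1.le h2.le h3.le ?_ (br_ii hcd hc)
    refine (ae_restrict_mem measurableSet_Ioc).mono (fun x hx => ?_)
    have := hx.1; have := hx.2
    exact mul_nonneg (mul_nonneg (by linarith) (by linarith)) (by positivity)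
  rw [intervalIntegral.integral_const_mul] at h7
  calc _ = m⁻¹ * (m * ∫ x in c'..d', ‖q n x‖ ^ 2) := by field_simp
    _ ≤ _ := by gcongr; linarith

/-- Balance: equipartition of energy. -/
lemma br_balance {c d : ℝ} (hcd : c < d) {lam : ℕ → ℝ}
    (hlt : Tendsto (fun n => |lam n|) atTop atTop) (hne : ∀ n, lam n ≠ 0) {s : ℂ}
    {q q1 q2 Q g : ℕ → ℝ → ℂ}
    (hd1 : ∀ n, ∀ x ∈ Icc c d, HasDerivAt (q n) (q1 n x) x)
    (hd2 : ∀ n, ∀ x ∈ Icc c d, HasDerivAt (q1 n) (q2 n x) x)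
    (heq : ∀ n, ∀ x ∈ Icc c d,
      (lam n : ℂ) ^ 2 * q n x + s * q2 n x = Q n x - Complex.I * lam n * g n x)
    (hlq : BrBd c d (fun n x => (lam n : ℂ) * q n x)) (hq1 : BrBd c d q1) (hQ : BrBd c d Q)
    (hg : BrNul c d g) :
    BrTN c d (fun n x => brh c d x *
      (s * (q1 n x * star (q1 n x)) - ((lam n : ℂ) * q n x) * star ((lam n : ℂ) * q n x))) := by
  have hq : BrNul c d q := hlq.small hcd.le hlt hne
  have t1 := ((hq.star.hmul hcd.le (brh'_cont c d)).mul hcd.le hq1).cmul s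
  have t2 := (hq.star.hmul hcd.le (brh_cont c d)).mul hcd.le hQ
  have t3 := ((hg.hmul hcd.le (brh_cont c d)).mul hcd.le hlq.star).cmul (-Complex.I)
  have t := ((t1.add hcd.le t2).add hcd.le t3).cmul (-1)
  have hc : ∀ n, ContinuousOn (fun x => brh c d x *
      (s * (q1 n x * star (q1 n x)) - ((lam n : ℂ) * q n x) * star ((lam n : ℂ) * q n x)))
      (Icc c d) := fun n => by
    have a1 := hq1.1 n
    have a2 := (hq1.1 n).star
    have a3 := hlq.1 n
    have a4 := (hlq.1 n).star
    have a5 := (brh_cont c d).continuousOn (s := Icc c d)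
    exact a5.mul ((continuousOn_const.mul (a1.mul a2)).sub (a3.mul a4))
  refine ⟨hc, t.2.congr (fun n => ?_)⟩
  rw [← sub_eq_zero, ← intervalIntegral.integral_sub (br_ii hcd.le (t.1 n)) (br_ii hcd.le (hc n)),
    ← neg_eq_zero, ← intervalIntegral.integral_neg]
  refine br_ftc hcd.le (φ := fun x => s * (brh c d x * (q1 n x * star (q n x))))
    ((t.1 n).sub (hc n)).neg ?_ ?_ ?_
  · intro x hx
    have := ((brh_deriv c d x).mul ((hd2 n x hx).mul (hd1 n x hx).star)).const_mul s
    refine this.congr_deriv ?_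
    have e := heq n x hx
    have e' : s * q2 n x = Q n x - Complex.I * lam n * g n x - (lam n : ℂ) ^ 2 * q n x := by
      rw [← e]; ring
    have e2 : star ((lam n : ℂ) * q n x) = (lam n : ℂ) * star (q n x) := by
      simp
    simp only [e2, Pi.mul_apply]
    linear_combination (brh c d x * star (q n x)) * e'
  · simp [brh]
  · simp [brh]

/-- Transfer lemma. -/
lemma br_transfer {c d : ℝ} (hcd : c < d) {lam : ℕ → ℝ} {s κ : ℝ} (hκ : κ ≠ 0)
    {p p1 p2 q q1 q2 Q R f f1 g g1 : ℕ → ℝ → ℂ}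
    (hp1 : ∀ n, ∀ x ∈ Icc c d, HasDerivAt (p n) (p1 n x) x)
    (hp2 : ∀ n, ∀ x ∈ Icc c d, HasDerivAt (p1 n) (p2 n x) x)
    (hq1 : ∀ n, ∀ x ∈ Icc c d, HasDerivAt (q n) (q1 n x) x)
    (hq2 : ∀ n, ∀ x ∈ Icc c d, HasDerivAt (q1 n) (q2 n x) x)
    (hf1 : ∀ n, ∀ x ∈ Icc c d, HasDerivAt (f n) (f1 n x) x)
    (hg1 : ∀ n, ∀ x ∈ Icc c d, HasDerivAt (g n) (g1 n x) x)
    (heqp : ∀ n, ∀ x ∈ Icc c d,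
      (lam n : ℂ) ^ 2 * p n x + s * p2 n x = κ * q1 n x + R n x - Complex.I * lam n * f n x)
    (heqq : ∀ n, ∀ x ∈ Icc c d,
      (lam n : ℂ) ^ 2 * q n x + s * q2 n x = Q n x - Complex.I * lam n * g n x)
    (bp : BrNul c d (fun n x => (lam n : ℂ) * p n x)) (bp1 : BrNul c d p1)
    (bq : BrBd c d (fun n x => (lam n : ℂ) * q n x)) (bq1 : BrBd c d q1)
    (bQ : BrBd c d Q) (bR : BrNul c d R) (bf : BrNul c d f) (bf1 : BrNul c d f1)
    (bg : BrNul c d g) (bg1 : BrNul c d g1) :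
    BrTN c d (fun n x => brh c d x * (q1 n x * star (q1 n x))) := by
  have hh := brh_cont c d
  have hh' := brh'_cont c d
  have t1 := (bp.hmul hcd.le hh').mul hcd.le bq.star
  have t2 := ((bp1.hmul hcd.le hh').mul hcd.le bq1.star).cmul s
  have t3 := ((bf.hmul hcd.le hh').mul hcd.le bq.star).cmul Complex.I
  have t4 := ((bp.hmul hcd.le hh').mul hcd.le bg.bd.star).cmul (-Complex.I)
  have t5 := (bR.hmul hcd.le hh).mul hcd.le bq1.star
  have t6 := (bp1.hmul hcd.le hh).mul hcd.le bQ.star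
  have t7 := ((bf1.hmul hcd.le hh).mul hcd.le bq.star).cmul Complex.I
  have t8 := ((bp.hmul hcd.le hh).mul hcd.le bg1.bd.star).cmul (-Complex.I)
  have t := (((((((t1.add hcd.le t2).add hcd.le t3).add hcd.le t4).add hcd.le t5).add hcd.le
    t6).add hcd.le t7).add hcd.le t8).cmul (-(κ : ℂ)⁻¹)
  have hκ' : (κ : ℂ) ≠ 0 := by exact_mod_cast hκ
  have hc : ∀ n, ContinuousOn (fun x => brh c d x * (q1 n x * star (q1 n x)))
      (Icc c d) := fun n => hh.continuousOn.mul ((bq1.1 n).mul (bq1.1 n).star)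
  refine ⟨hc, t.2.congr (fun n => ?_)⟩
  rw [← sub_eq_zero, ← intervalIntegral.integral_sub (br_ii hcd.le (t.1 n)) (br_ii hcd.le (hc n))]
  refine br_ftc hcd.le (φ := fun x => -(κ : ℂ)⁻¹ * (brh c d x *
      ((lam n : ℂ) ^ 2 * (p n x * star (q n x)) + s * (p1 n x * star (q1 n x))
        + Complex.I * lam n * (f n x * star (q n x)) - Complex.I * lam n * (p n x * star (g n x)))))
    ((t.1 n).sub (hc n)) ?_ ?_ ?_
  · intro x hx
    have P1 := hp1 n x hx
    have P2 := hp2 n x hx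
    have Q1 := (hq1 n x hx).star
    have Q2 := (hq2 n x hx).star
    have F1 := hf1 n x hx
    have G1 := (hg1 n x hx).star
    have := ((brh_deriv c d x).mul (((((P1.mul Q1).const_mul ((lam n : ℂ) ^ 2)).add
      ((P2.mul Q2).const_mul (s : ℂ))).add ((F1.mul Q1).const_mul (Complex.I * lam n))).sub
      ((P1.mul G1).const_mul (Complex.I * lam n)))).const_mul (-(κ : ℂ)⁻¹)
    refine this.congr_deriv ?_
    have e1 := heqp n x hx
    have e2 := congrArg star (heqq n x hx)
    simp only [star_add, star_sub, star_mul', star_pow, Complex.star_def, Complex.conj_I,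
      Complex.conj_ofReal] at e2
    simp only [star_mul', Complex.star_def, Complex.conj_ofReal]
    have hi : (κ : ℂ)⁻¹ * κ = 1 := inv_mul_cancel₀ hκ'
    simp only [Pi.add_apply, Pi.mul_apply, Pi.sub_apply]
    linear_combination (-(κ : ℂ)⁻¹ * brh c d x * (starRingEnd ℂ) (q1 n x)) * e1
      + (-(κ : ℂ)⁻¹ * brh c d x * p1 n x) * e2
      - (brh c d x * q1 n x * (starRingEnd ℂ) (q1 n x)) * hi
  · simp [brh]
  · simp [brh]

lemma br_r1 {a b x : ℝ} {f : ℝ → ℂ} (hf : ContDiffOn ℝ 1 f (Icc a b)) (hx : x ∈ Ioo a b) :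
    HasDerivAt f (deriv f x) x :=
  (((hf.contDiffAt (Icc_mem_nhds hx.1 hx.2))).differentiableAt (by norm_num)).hasDerivAt

lemma br_r2 {a b x : ℝ} {f : ℝ → ℂ} (hf : ContDiffOn ℝ 2 f (Icc a b)) (hx : x ∈ Ioo a b) :
    HasDerivAt (deriv f) (deriv (deriv f) x) x := by
  have h1 : ContDiffOn ℝ 2 f (Ioo a b) := hf.mono Ioo_subset_Icc_self
  have h2 : ContDiffOn ℝ 1 (deriv f) (Ioo a b) :=
    h1.deriv_of_isOpen isOpen_Ioo (by norm_num)
  exact ((h2.contDiffAt (Ioo_mem_nhds hx.1 hx.2)).differentiableAt (by norm_num)).hasDerivAt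

lemma br_r3 {a b : ℝ} {f : ℝ → ℂ} (hf : ContDiffOn ℝ 1 f (Icc a b)) :
    ContinuousOn (deriv f) (Ioo a b) :=
  (hf.mono Ioo_subset_Icc_self).continuousOn_deriv_of_isOpen isOpen_Ioo (by norm_num)

lemma br_r4 {a b : ℝ} (hab : a < b) {f : ℝ → ℂ} (hf : ContDiffOn ℝ 1 f (Icc a b)) :
    ContinuousOn (derivWithin f (Icc a b)) (Icc a b) :=
  hf.continuousOn_derivWithin (uniqueDiffOn_Icc hab) (by norm_num)

lemma br_r4' {a b x : ℝ} {f : ℝ → ℂ} (hx : x ∈ Ioo a b) :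
    derivWithin f (Icc a b) x = deriv f x :=
  derivWithin_of_mem_nhds (Icc_mem_nhds hx.1 hx.2)

lemma br_r5 {a b : ℝ} (hab : a ≤ b) {g g' : ℝ → ℝ} (hg : ContinuousOn g' (Icc a b))
    (h : ∀ x ∈ Ioo a b, g x = g' x) : IntervalIntegrable g volume a b := by
  have h1 := br_ii hab hg
  rw [intervalIntegrable_iff_integrableOn_Ioo_of_le hab] at h1 ⊢
  exact h1.congr_fun (fun x hx => (h x hx).symm) measurableSet_Ioo

/-- generic energy density -/
def brE (ρ₁ ρ₂ k₁ k₂ k₃ l : ℝ) (v1 v2 v3 v4 v5 v6 : ℝ → ℂ) (x : ℝ) : ℝ :=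
  k₁ * ‖deriv v1 x + v3 x + (l : ℂ) * v5 x‖ ^ 2 + ρ₁ * ‖v2 x‖ ^ 2
        + k₂ * ‖deriv v3 x‖ ^ 2 + ρ₂ * ‖v4 x‖ ^ 2
        + k₃ * ‖deriv v5 x - (l : ℂ) * v1 x‖ ^ 2 + ρ₁ * ‖v6 x‖ ^ 2

lemma brE_int {ρ₁ ρ₂ k₁ k₂ k₃ l L : ℝ} (hL : 0 < L) {v1 v2 v3 v4 v5 v6 : ℝ → ℂ}
    (h1 : ContDiffOn ℝ 1 v1 (Icc 0 L)) (h2 : ContinuousOn v2 (Icc 0 L))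
    (h3 : ContDiffOn ℝ 1 v3 (Icc 0 L)) (h4 : ContinuousOn v4 (Icc 0 L))
    (h5 : ContDiffOn ℝ 1 v5 (Icc 0 L)) (h6 : ContinuousOn v6 (Icc 0 L)) :
    IntervalIntegrable (brE ρ₁ ρ₂ k₁ k₂ k₃ l v1 v2 v3 v4 v5 v6) volume 0 L := by
  refine br_r5 hL.le (g' := fun x =>
    k₁ * ‖derivWithin v1 (Icc 0 L) x + v3 x + (l : ℂ) * v5 x‖ ^ 2 + ρ₁ * ‖v2 x‖ ^ 2
        + k₂ * ‖derivWithin v3 (Icc 0 L) x‖ ^ 2 + ρ₂ * ‖v4 x‖ ^ 2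
        + k₃ * ‖derivWithin v5 (Icc 0 L) x - (l : ℂ) * v1 x‖ ^ 2 + ρ₁ * ‖v6 x‖ ^ 2) ?_ ?_
  · have a1 := br_r4 hL h1
    have a3 := br_r4 hL h3
    have a5 := br_r4 hL h5
    have b1 := h1.continuousOn
    have b3 := h3.continuousOn
    have b5 := h5.continuousOn
    fun_prop
  · intro x hx
    simp only [brE, br_r4' hx]

lemma brE_comp {ρ₁ ρ₂ k₁ k₂ k₃ l : ℝ} (hrho1 : 0 < ρ₁) (hrho2 : 0 < ρ₂) (hk1 : 0 < k₁)
    (hk2 : 0 < k₂) (hk3 : 0 < k₃) (v1 v2 v3 v4 v5 v6 : ℝ → ℂ) (x : ℝ) :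
    let E := brE ρ₁ ρ₂ k₁ k₂ k₃ l v1 v2 v3 v4 v5 v6 x
    0 ≤ E ∧ k₁ * ‖deriv v1 x + v3 x + (l : ℂ) * v5 x‖ ^ 2 ≤ E ∧ ρ₁ * ‖v2 x‖ ^ 2 ≤ E ∧
      k₂ * ‖deriv v3 x‖ ^ 2 ≤ E ∧ ρ₂ * ‖v4 x‖ ^ 2 ≤ E ∧
      k₃ * ‖deriv v5 x - (l : ℂ) * v1 x‖ ^ 2 ≤ E ∧ ρ₁ * ‖v6 x‖ ^ 2 ≤ E := by
  have a1 : 0 ≤ k₁ * ‖deriv v1 x + v3 x + (l : ℂ) * v5 x‖ ^ 2 := by positivity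
  have a2 : 0 ≤ ρ₁ * ‖v2 x‖ ^ 2 := by positivity
  have a3 : 0 ≤ k₂ * ‖deriv v3 x‖ ^ 2 := by positivity
  have a4 : 0 ≤ ρ₂ * ‖v4 x‖ ^ 2 := by positivity
  have a5 : 0 ≤ k₃ * ‖deriv v5 x - (l : ℂ) * v1 x‖ ^ 2 := by positivity
  have a6 : 0 ≤ ρ₁ * ‖v6 x‖ ^ 2 := by positivity
  simp only [brE]
  refine ⟨?_, ?_, ?_, ?_, ?_, ?_, ?_⟩ <;> linarith

/-- Component estimate. -/
lemma br_comp {c d L k : ℝ} (hc : 0 < c) (hcd : c < d) (hd : d < L) (hk : 0 < k) {e : ℝ → ℝ}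
    (he : IntervalIntegrable e volume 0 L) (he0 : ∀ x, 0 ≤ e x) {Z : ℝ → ℂ}
    (hZ : ContinuousOn Z (Icc c d)) (hZe : ∀ x, k * ‖Z x‖ ^ 2 ≤ e x) :
    ∫ x in c..d, ‖Z x‖ ^ 2 ≤ k⁻¹ * ∫ x in (0 : ℝ)..L, e x := by
  have h1 : ∫ x in c..d, k * ‖Z x‖ ^ 2 ≤ ∫ x in c..d, e x := by
    refine intervalIntegral.integral_mono_on hcd.le ((br_sqi hcd.le hZ).const_mul k)
      (he.mono_set ?_) (fun x _ => hZe x)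
    rw [uIcc_of_le hcd.le, uIcc_of_le (by linarith)]
    exact Icc_subset_Icc hc.le hd.le
  have h2 : ∫ x in c..d, e x ≤ ∫ x in (0 : ℝ)..L, e x :=
    intervalIntegral.integral_mono_interval hc.le hcd.le hd.le
      (Eventually.of_forall he0) he
  rw [intervalIntegral.integral_const_mul] at h1
  calc _ = k⁻¹ * (k * ∫ x in c..d, ‖Z x‖ ^ 2) := by field_simp
    _ ≤ _ := by gcongr; linarith

lemma br_re_le (z w : ℂ) {t : ℝ} (ht : 0 < t) :
    (z * star w).re ≤ t / 2 * ‖w‖ ^ 2 + t⁻¹ / 2 * ‖z‖ ^ 2 := by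
  have h1 : (z * star w).re ≤ ‖z‖ * ‖w‖ := by
    have := Complex.re_le_norm (z * star w)
    rwa [norm_mul, norm_star] at this
  have : t / 2 * ‖w‖ ^ 2 + t⁻¹ / 2 * ‖z‖ ^ 2 - ‖z‖ * ‖w‖ = t⁻¹ / 2 * (‖z‖ - t * ‖w‖) ^ 2 := by
    field_simp; ring
  have h5 : 0 ≤ t⁻¹ / 2 * (‖z‖ - t * ‖w‖) ^ 2 := by positivity
  linarith

/-- Uniform smallness of f1, f3, f5. -/
lemma br_gron {L l : ℝ} (hL : 0 < L) {f1 f3 f5 : ℝ → ℂ} {e : ℝ → ℝ}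
    (h1 : ContDiffOn ℝ 1 f1 (Icc 0 L)) (h3 : ContDiffOn ℝ 1 f3 (Icc 0 L))
    (h5 : ContDiffOn ℝ 1 f5 (Icc 0 L)) (z1 : f1 0 = 0) (z3 : f3 0 = 0) (z5 : f5 0 = 0)
    (he : IntervalIntegrable e volume 0 L) (he0 : ∀ x, 0 ≤ e x)
    (hle : ∀ x, ‖deriv f1 x + f3 x + (l : ℂ) * f5 x‖ ^ 2 + ‖deriv f3 x‖ ^ 2
      + ‖deriv f5 x - (l : ℂ) * f1 x‖ ^ 2 ≤ e x) {x : ℝ} (hx : x ∈ Icc 0 L) :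
    ‖f1 x‖ ^ 2 + ‖f3 x‖ ^ 2 + ‖f5 x‖ ^ 2 ≤ Real.exp (2 * L) * ∫ y in (0 : ℝ)..L, e y := by
  have hin : ∀ f : ℝ → ℂ, ContDiffOn ℝ 1 f (Icc 0 L) → ∀ y ∈ Ioo 0 x,
      HasDerivAt (fun y => ‖f y‖ ^ 2) (2 * (f y * star (deriv f y)).re) y := by
    intro f hf y hy
    have hd := br_r1 hf (x := y) ⟨hy.1, hy.2.trans_le hx.2⟩
    have := hd.norm_sq
    refine this.congr_deriv ?_
    rw [Complex.inner]
    simp [mul_comm]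
  have key := intervalIntegral.sub_le_integral_of_hasDeriv_right_of_le (a := 0) (b := x)
    (g := fun y => Real.exp (-2 * y) * (‖f1 y‖ ^ 2 + ‖f3 y‖ ^ 2 + ‖f5 y‖ ^ 2))
    (g' := fun y => (Real.exp (-2 * y) * (-2)) * (‖f1 y‖ ^ 2 + ‖f3 y‖ ^ 2 + ‖f5 y‖ ^ 2)
      + Real.exp (-2 * y) * (2 * (f1 y * star (deriv f1 y)).re + 2 * (f3 y * star (deriv f3 y)).re
        + 2 * (f5 y * star (deriv f5 y)).re)) (φ := e) hx.1 ?_ ?_ ?_ ?_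
  · have h2 : ∫ y in (0 : ℝ)..x, e y ≤ ∫ y in (0 : ℝ)..L, e y :=
      intervalIntegral.integral_mono_interval le_rfl hx.1 hx.2 (Eventually.of_forall he0) he
    simp only [z1, z3, z5] at key
    norm_num at key
    have h6 : Real.exp (2 * x) ≤ Real.exp (2 * L) := Real.exp_le_exp.2 (by linarith [hx.2])
    have h7 : 0 ≤ ∫ y in (0 : ℝ)..L, e y :=
      intervalIntegral.integral_nonneg hL.le (fun y _ => he0 y)
    calc _ = Real.exp (2 * x) * (Real.exp (-(2 * x)) * (‖f1 x‖ ^ 2 + ‖f3 x‖ ^ 2 + ‖f5 x‖ ^ 2)) := by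
          rw [← mul_assoc, ← Real.exp_add]; simp
      _ ≤ Real.exp (2 * x) * ∫ y in (0 : ℝ)..L, e y := by gcongr; linarith
      _ ≤ _ := by gcongr
  · have b1 := h1.continuousOn.mono (Icc_subset_Icc_right hx.2)
    have b3 := h3.continuousOn.mono (Icc_subset_Icc_right hx.2)
    have b5 := h5.continuousOn.mono (Icc_subset_Icc_right hx.2)
    fun_prop
  · intro y hy
    have e0 : HasDerivAt (fun y : ℝ => Real.exp (-2 * y)) (Real.exp (-2 * y) * (-2)) y := by
      have := ((hasDerivAt_id y).const_mul (-2 : ℝ)).exp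
      simpa using this
    exact (e0.mul (((hin f1 h1 y hy).add (hin f3 h3 y hy)).add (hin f5 h5 y hy))).hasDerivWithinAt
  · rw [integrableOn_Icc_iff_integrableOn_Ioc]
    have := (intervalIntegrable_iff_integrableOn_Ioc_of_le hL.le).1 he
    exact this.mono_set (Ioc_subset_Ioc_right hx.2)
  · intro y hy
    have := hle y
    have hE : 0 < Real.exp (-2 * y) := Real.exp_pos _
    have hE1 : Real.exp (-2 * y) ≤ 1 := Real.exp_le_one_iff.2 (by linarith [hy.1])
    set g := deriv f1 y + f3 y + (l : ℂ) * f5 y with hg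
    set h := deriv f5 y - (l : ℂ) * f1 y with hh
    have d1 : deriv f1 y = g - f3 y - l * f5 y := by rw [hg]; ring
    have d5 : deriv f5 y = h + l * f1 y := by rw [hh]; ring
    have q1 := br_re_le (f1 y) g one_pos
    have q2 := br_re_le (f1 y) (-f3 y) one_pos
    have q3 := br_re_le (f3 y) (deriv f3 y) one_pos
    have q4 := br_re_le (f5 y) h one_pos
    have hs : 2 * (f1 y * star (deriv f1 y)).re + 2 * (f3 y * star (deriv f3 y)).re
        + 2 * (f5 y * star (deriv f5 y)).re - 2 * (‖f1 y‖ ^ 2 + ‖f3 y‖ ^ 2 + ‖f5 y‖ ^ 2) ≤ e y := by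
      have i1 : (f1 y * star (deriv f1 y)).re + (f5 y * star (deriv f5 y)).re =
          (f1 y * star g).re + (f1 y * star (-f3 y)).re + (f5 y * star h).re := by
        rw [d1, d5]
        simp
        ring
      rw [norm_neg] at q2
      norm_num at q1 q2 q3 q4
      norm_num at i1 ⊢
      nlinarith [sq_nonneg ‖f5 y‖, sq_nonneg ‖f3 y‖, sq_nonneg ‖f1 y‖]
    have h0 := he0 y
    calc _ = Real.exp (-2 * y) * (2 * (f1 y * star (deriv f1 y)).re
          + 2 * (f3 y * star (deriv f3 y)).re
          + 2 * (f5 y * star (deriv f5 y)).re - 2 * (‖f1 y‖ ^ 2 + ‖f3 y‖ ^ 2 + ‖f5 y‖ ^ 2)) := by ring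
      _ ≤ Real.exp (-2 * y) * e y := by gcongr
      _ ≤ 1 * e y := by gcongr
      _ = e y := one_mul _

/-- Pointwise dissipation identity. -/
lemma br_pt {ρ₁ ρ₂ k₁ k₂ k₃ l lam a t : ℝ} (hrho1 : 0 < ρ₁) (hrho2 : 0 < ρ₂) (hk1 : 0 < k₁)
    (hk2 : 0 < k₂) (hk3 : 0 < k₃) (ht : 0 < t)
    {u u1 v2 A A' ψ ψ1 ψ2 v4 w w1 v6 C C' f1 f1' f2 f3 f3' f4 f5 f5' f6 : ℂ}
    (hA : A = u1 + ψ + l * w) (hC : C = w1 - l * u)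
    (e1 : Complex.I * lam * u - v2 = f1)
    (e2 : Complex.I * lam * ρ₁ * v2 - k₁ * A' - l * k₃ * C = ρ₁ * f2)
    (e3 : Complex.I * lam * ψ - v4 = f3)
    (e4 : Complex.I * lam * ρ₂ * v4 - k₂ * ψ2 + k₁ * A = ρ₂ * f4)
    (e5 : Complex.I * lam * w - v6 = f5)
    (e6 : Complex.I * lam * ρ₁ * v6 - k₃ * C' + l * k₁ * A + a * v6 = ρ₁ * f6) :
    a * ‖v6‖ ^ 2 - t / 2 * (k₁ * ‖A‖ ^ 2 + ρ₁ * ‖v2‖ ^ 2 + k₂ * ‖ψ1‖ ^ 2 + ρ₂ * ‖v4‖ ^ 2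
        + k₃ * ‖C‖ ^ 2 + ρ₁ * ‖v6‖ ^ 2)
      - t⁻¹ / 2 * (k₁ * ‖f1' + f3 + l * f5‖ ^ 2 + ρ₁ * ‖f2‖ ^ 2 + k₂ * ‖f3'‖ ^ 2
        + ρ₂ * ‖f4‖ ^ 2 + k₃ * ‖f5' - l * f1‖ ^ 2 + ρ₁ * ‖f6‖ ^ 2) ≤
    (k₁ * (A' * star v2 + A * star (Complex.I * lam * u1 - f1'))
      + k₂ * (ψ2 * star v4 + ψ1 * star (Complex.I * lam * ψ1 - f3'))
      + k₃ * (C' * star v6 + C * star (Complex.I * lam * w1 - f5'))).re := by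
  have n : ∀ z : ℂ, z * star z = ((‖z‖ ^ 2 : ℝ) : ℂ) := fun z => by
    have := Complex.mul_conj z
    rw [Complex.normSq_eq_norm_sq] at this
    exact this
  have c1 := congrArg star e1
  have c3 := congrArg star e3
  have c5 := congrArg star e5
  have cA := congrArg star hA
  have cC := congrArg star hC
  have n2 := n v2
  have n4 := n v4
  have n6 := n v6
  have nA := n A
  have nC := n C
  have nP := n ψ1
  have key : k₁ * (A' * star v2 + A * star (Complex.I * lam * u1 - f1'))
      + k₂ * (ψ2 * star v4 + ψ1 * star (Complex.I * lam * ψ1 - f3'))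
      + k₃ * (C' * star v6 + C * star (Complex.I * lam * w1 - f5')) =
      Complex.I * ((lam * (ρ₁ * ‖v2‖ ^ 2 - k₁ * ‖A‖ ^ 2 + ρ₂ * ‖v4‖ ^ 2 - k₂ * ‖ψ1‖ ^ 2
        + ρ₁ * ‖v6‖ ^ 2 - k₃ * ‖C‖ ^ 2) : ℝ) : ℂ) + ((a * ‖v6‖ ^ 2 : ℝ) : ℂ)
      - (ρ₁ * (f2 * star v2) + k₁ * (A * star (f1' + f3 + l * f5)) + ρ₂ * (f4 * star v4)
        + k₂ * (ψ1 * star f3') + k₃ * (C * star (f5' - l * f1)) + ρ₁ * (f6 * star v6)) := by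
    simp only [star_add, star_sub, star_mul', Complex.star_def, Complex.conj_I,
      Complex.conj_ofReal] at *
    push_cast at *
    linear_combination (-(starRingEnd ℂ) v2) * e2 + (-(starRingEnd ℂ) v4) * e4 + (-(starRingEnd ℂ) v6) * e6
      + (Complex.I * lam * ρ₁) * n2 + (Complex.I * lam * ρ₂) * n4
      + (Complex.I * lam * ρ₁ + a) * n6 - (Complex.I * lam * k₁) * nA - (Complex.I * lam * k₂) * nP
      - (Complex.I * lam * k₃) * nC
      + (k₁ * A * Complex.I * lam) * cA + (k₃ * C * Complex.I * lam) * cC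
      + (l * k₃ * C) * c1 - (k₁ * A) * c3 - (k₁ * A * l) * c5
  rw [key]
  have r2 := br_re_le f2 v2 ht
  have r4 := br_re_le f4 v4 ht
  have r6 := br_re_le f6 v6 ht
  have rA := br_re_le A (f1' + f3 + l * f5) (inv_pos.2 ht)
  have rP := br_re_le ψ1 f3' (inv_pos.2 ht)
  have rC := br_re_le C (f5' - l * f1) (inv_pos.2 ht)
  rw [inv_inv] at rA rP rC
  simp only [Complex.sub_re, Complex.add_re, Complex.re_ofReal_mul, Complex.ofReal_re]
  rw [Complex.I_mul_re, Complex.ofReal_im]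
  have m2 := mul_le_mul_of_nonneg_left r2 hrho1.le
  have m4 := mul_le_mul_of_nonneg_left r4 hrho2.le
  have m6 := mul_le_mul_of_nonneg_left r6 hrho1.le
  have mA := mul_le_mul_of_nonneg_left rA hk1.le
  have mP := mul_le_mul_of_nonneg_left rP hk2.le
  have mC := mul_le_mul_of_nonneg_left rC hk3.le
  linarith

lemma br_piece {ρ₁ ρ₂ k₁ k₂ k₃ l L β a₀ : ℝ}
    (hrho1 : 0 < ρ₁) (hrho2 : 0 < ρ₂) (hk1 : 0 < k₁) (hk2 : 0 < k₂) (hk3 : 0 < k₃)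
    (hL : 0 < L) (S : BresseSetting ρ₁ ρ₂ k₁ k₂ k₃ l L β a₀ 0) (n : ℕ) {t : ℝ} (ht : 0 < t)
    {p q a : ℝ} (hpq : p < q) (hsub : Icc p q ⊆ Icc 0 L)
    (hsub' : Ioo p q ⊆ Ioo (0 : ℝ) β ∪ Ioo β L) (hv5 : ContDiffOn ℝ 2 (S.v5 n) (Icc p q))
    (ha : ∀ x ∈ Ioo p q, (if x < β then (a₀ : ℂ) else 0) = a)
    (G : ℝ → ℝ) (hG : ∀ x, G x = (
      k₁ * ((derivWithin (S.v1 n) (Icc 0 L) x + S.v3 n x + l * S.v5 n x) * star (S.v2 n x))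
      + k₂ * (derivWithin (S.v3 n) (Icc 0 L) x * star (S.v4 n x))
      + k₃ * ((derivWithin (S.v5 n) (Icc 0 L) x - l * S.v1 n x) * star (S.v6 n x))).re) :
    a * (∫ x in p..q, ‖S.v6 n x‖ ^ 2)
      - t / 2 * (∫ x in p..q, brE ρ₁ ρ₂ k₁ k₂ k₃ l (S.v1 n) (S.v2 n) (S.v3 n) (S.v4 n)
        (S.v5 n) (S.v6 n) x)
      - t⁻¹ / 2 * (∫ x in p..q, brE ρ₁ ρ₂ k₁ k₂ k₃ l (S.f1 n) (S.f2 n) (S.f3 n) (S.f4 n)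
        (S.f5 n) (S.f6 n) x) ≤ G q - G p := by
  have c1 : ContDiffOn ℝ 1 (S.v1 n) (Icc 0 L) := (S.reg_v1 n).of_le (by norm_num)
  have c3 : ContDiffOn ℝ 1 (S.v3 n) (Icc 0 L) := (S.reg_v3 n).of_le (by norm_num)
  have sub2 : uIcc p q ⊆ uIcc 0 L := by
    rwa [uIcc_of_le hpq.le, uIcc_of_le hL.le]
  have hL' : Ioo p q ⊆ Ioo 0 L := by
    have h0 := hsub (left_mem_Icc.2 hpq.le)
    have h1 := hsub (right_mem_Icc.2 hpq.le)
    exact Ioo_subset_Ioo h0.1 h1.2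
  have iU := (brE_int (ρ₁ := ρ₁) (ρ₂ := ρ₂) (k₁ := k₁) (k₂ := k₂) (k₃ := k₃) (l := l) hL c1
    (S.reg_v2 n).continuousOn c3 (S.reg_v4 n).continuousOn (S.reg_v5 n)
    (S.reg_v6 n).continuousOn).mono_set sub2
  have iF := (brE_int (ρ₁ := ρ₁) (ρ₂ := ρ₂) (k₁ := k₁) (k₂ := k₂) (k₃ := k₃) (l := l) hL
    (S.reg_f1 n) (S.reg_f2 n) (S.reg_f3 n) (S.reg_f4 n) (S.reg_f5 n) (S.reg_f6 n)).mono_set sub2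
  have i6 := br_sqi hpq.le ((S.reg_v6 n).continuousOn.mono hsub)
  rw [← intervalIntegral.integral_const_mul, ← intervalIntegral.integral_const_mul,
    ← intervalIntegral.integral_const_mul, ← intervalIntegral.integral_sub (i6.const_mul _)
      (iU.const_mul _), ← intervalIntegral.integral_sub ((i6.const_mul _).sub (iU.const_mul _))
      (iF.const_mul _)]
  have hG' : G = fun x => (
      k₁ * ((derivWithin (S.v1 n) (Icc 0 L) x + S.v3 n x + l * S.v5 n x) * star (S.v2 n x))
      + k₂ * (derivWithin (S.v3 n) (Icc 0 L) x * star (S.v4 n x))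
      + k₃ * ((derivWithin (S.v5 n) (Icc 0 L) x - l * S.v1 n x) * star (S.v6 n x))).re := by
    funext x; exact hG x
  refine intervalIntegral.integral_le_sub_of_hasDeriv_right_of_le (g := G)
    (g' := fun x => (k₁ * (deriv (fun y => deriv (S.v1 n) y + S.v3 n y + (l : ℂ) * S.v5 n y) x
        * star (S.v2 n x) + (deriv (S.v1 n) x + S.v3 n x + (l : ℂ) * S.v5 n x)
          * star (Complex.I * S.lam n * deriv (S.v1 n) x - deriv (S.f1 n) x))
      + k₂ * (deriv (deriv (S.v3 n)) x * star (S.v4 n x) + deriv (S.v3 n) x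
          * star (Complex.I * S.lam n * deriv (S.v3 n) x - deriv (S.f3 n) x))
      + k₃ * (deriv (fun y => deriv (S.v5 n) y - (l : ℂ) * S.v1 n y) x * star (S.v6 n x)
        + (deriv (S.v5 n) x - (l : ℂ) * S.v1 n x)
          * star (Complex.I * S.lam n * deriv (S.v5 n) x - deriv (S.f5 n) x))).re) hpq.le ?_ ?_ ?_ ?_
  · rw [hG']
    have d1 := (br_r4 hL c1)
    have d3 := (br_r4 hL c3)
    have d5 := (br_r4 hL (S.reg_v5 n))
    have b1 := c1.continuousOn
    have b3 := c3.continuousOn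
    have b5 := (S.reg_v5 n).continuousOn
    have b2 := (S.reg_v2 n).continuousOn.star
    have b4 := (S.reg_v4 n).continuousOn.star
    have b6 := (S.reg_v6 n).continuousOn.star
    refine (Complex.continuous_re.comp_continuousOn ?_).mono hsub
    exact ((continuousOn_const.mul (((d1.add b3).add (continuousOn_const.mul b5)).mul b2)).add
      (continuousOn_const.mul (d3.mul b4))).add
      (continuousOn_const.mul ((d5.sub (continuousOn_const.mul b1)).mul b6))
  · intro x hx
    have hxL := hL' hx
    have hnh : Ioo p q ∈ nhds x := Ioo_mem_nhds hx.1 hx.2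
    have D1 := br_r1 c1 hxL
    have D3 := br_r1 c3 hxL
    have D5 := br_r1 (S.reg_v5 n) hxL
    have D11 := br_r2 (S.reg_v1 n) hxL
    have D33 := br_r2 (S.reg_v3 n) hxL
    have D55 := br_r2 hv5 hx
    have DA := ((D11.add D3).add (D5.const_mul (l : ℂ))).differentiableAt.hasDerivAt
    have DC := (D55.sub (D1.const_mul (l : ℂ))).differentiableAt.hasDerivAt
    have veq : ∀ {v w f : ℝ → ℂ}, (∀ y ∈ Ioo (0 : ℝ) β ∪ Ioo β L,
        Complex.I * (S.lam n : ℂ) * v y - w y = (S.lam n : ℂ) ^ (-((0 : ℕ) : ℤ)) * f y) →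
        ContDiffOn ℝ 1 v (Icc 0 L) → ContDiffOn ℝ 1 f (Icc 0 L) →
        HasDerivAt w (Complex.I * S.lam n * deriv v x - deriv f x) x := by
      intro v w f h hv hf
      have := ((br_r1 hv hxL).const_mul (Complex.I * S.lam n)).sub (br_r1 hf hxL)
      refine this.congr_of_eventuallyEq ?_
      filter_upwards [hnh] with y hy
      have := h y (hsub' hy)
      simp only [Nat.cast_zero, neg_zero, zpow_zero, one_mul] at this
      rw [Pi.sub_apply, ← this]; ring
    have V2 := veq (S.eq1 n) c1 (S.reg_f1 n)
    have V4 := veq (S.eq3 n) c3 (S.reg_f3 n)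
    have V6 := veq (S.eq5 n) (S.reg_v5 n) (S.reg_f5 n)
    have T := (((DA.mul V2.star).const_mul (k₁ : ℂ)).add
      ((D33.mul V4.star).const_mul (k₂ : ℂ))).add ((DC.mul V6.star).const_mul (k₃ : ℂ))
    have T2 := Complex.reCLM.hasFDerivAt.comp_hasDerivAt x T
    refine HasDerivAt.hasDerivWithinAt ?_
    refine T2.congr_of_eventuallyEq ?_
    filter_upwards [hnh] with y hy
    rw [hG]
    simp only [br_r4' (hL' hy)]
    rfl
  · rw [integrableOn_Icc_iff_integrableOn_Ioc]
    exact (intervalIntegrable_iff_integrableOn_Ioc_of_le hpq.le).1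
      (((i6.const_mul _).sub (iU.const_mul _)).sub (iF.const_mul _))
  · intro x hx
    have e1 := S.eq1 n x (hsub' hx)
    have e2 := S.eq2 n x (hsub' hx)
    have e3 := S.eq3 n x (hsub' hx)
    have e4 := S.eq4 n x (hsub' hx)
    have e5 := S.eq5 n x (hsub' hx)
    have e6 := S.eq6 n x (hsub' hx)
    rw [ha x hx] at e6
    simp only [Nat.cast_zero, neg_zero, zpow_zero, one_mul, mul_one] at e1 e2 e3 e4 e5 e6
    exact br_pt hrho1 hrho2 hk1 hk2 hk3 ht rfl rfl e1 e2 e3 e4 e5 e6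

lemma br_diss {ρ₁ ρ₂ k₁ k₂ k₃ l L β a₀ : ℝ}
    (hrho1 : 0 < ρ₁) (hrho2 : 0 < ρ₂) (hk1 : 0 < k₁) (hk2 : 0 < k₂) (hk3 : 0 < k₃)
    (hL : 0 < L) (ha0 : 0 < a₀) (hbeta : 0 < β) (hbetaL : β < L)
    (S : BresseSetting ρ₁ ρ₂ k₁ k₂ k₃ l L β a₀ 0) :
    Tendsto (fun n => ∫ x in (0 : ℝ)..β, ‖S.v6 n x‖ ^ 2) atTop (nhds 0) := by
  have main : ∀ n, ∀ t : ℝ, 0 < t → a₀ * (∫ x in (0 : ℝ)..β, ‖S.v6 n x‖ ^ 2) ≤ t / 2 +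
      t⁻¹ / 2 * (∫ x in (0 : ℝ)..L, brE ρ₁ ρ₂ k₁ k₂ k₃ l (S.f1 n) (S.f2 n) (S.f3 n) (S.f4 n)
        (S.f5 n) (S.f6 n) x) := by
    intro n t ht
    have c1 : ContDiffOn ℝ 1 (S.v1 n) (Icc 0 L) := (S.reg_v1 n).of_le (by norm_num)
    have c3 : ContDiffOn ℝ 1 (S.v3 n) (Icc 0 L) := (S.reg_v3 n).of_le (by norm_num)
    have iU := (brE_int (ρ₁ := ρ₁) (ρ₂ := ρ₂) (k₁ := k₁) (k₂ := k₂) (k₃ := k₃) (l := l) hL c1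
      (S.reg_v2 n).continuousOn c3 (S.reg_v4 n).continuousOn (S.reg_v5 n)
      (S.reg_v6 n).continuousOn)
    have iF := (brE_int (ρ₁ := ρ₁) (ρ₂ := ρ₂) (k₁ := k₁) (k₂ := k₂) (k₃ := k₃) (l := l) hL
      (S.reg_f1 n) (S.reg_f2 n) (S.reg_f3 n) (S.reg_f4 n) (S.reg_f5 n) (S.reg_f6 n))
    have s1 : uIcc 0 β ⊆ uIcc 0 L := by
      rw [uIcc_of_le hbeta.le, uIcc_of_le hL.le]; exact Icc_subset_Icc_right hbetaL.le
    have s2 : uIcc β L ⊆ uIcc 0 L := by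
      rw [uIcc_of_le hbetaL.le, uIcc_of_le hL.le]; exact Icc_subset_Icc_left hbeta.le
    set G : ℝ → ℝ := fun x => (
      k₁ * ((derivWithin (S.v1 n) (Icc 0 L) x + S.v3 n x + l * S.v5 n x) * star (S.v2 n x))
      + k₂ * (derivWithin (S.v3 n) (Icc 0 L) x * star (S.v4 n x))
      + k₃ * ((derivWithin (S.v5 n) (Icc 0 L) x - l * S.v1 n x) * star (S.v6 n x))).re with hG
    have p1 := br_piece hrho1 hrho2 hk1 hk2 hk3 hL S n ht (a := a₀) hbeta
      (Icc_subset_Icc_right hbetaL.le) subset_union_left (S.reg_v5_left n)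
      (fun x hx => if_pos hx.2) G (fun x => rfl)
    have p2 := br_piece hrho1 hrho2 hk1 hk2 hk3 hL S n ht (a := 0) hbetaL
      (Icc_subset_Icc_left hbeta.le) subset_union_right (S.reg_v5_right n)
      (fun x hx => by rw [if_neg (not_lt.2 hx.1.le)]; simp) G (fun x => rfl)
    have g0 : G 0 = 0 := by
      obtain ⟨h1, h2, h3, h4, h5, h6, -⟩ := S.bc_zero n
      simp [hG, h2, h4, h6]
    have gL : G L = 0 := by
      obtain ⟨h1, h2, h3, h4, h5, h6, -⟩ := S.bc_L n
      simp [hG, h2, h4, h6]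
    have aU := intervalIntegral.integral_add_adjacent_intervals (iU.mono_set s1) (iU.mono_set s2)
    have aF := intervalIntegral.integral_add_adjacent_intervals (iF.mono_set s1) (iF.mono_set s2)
    have nU : ∫ x in (0 : ℝ)..L, brE ρ₁ ρ₂ k₁ k₂ k₃ l (S.v1 n) (S.v2 n) (S.v3 n) (S.v4 n)
        (S.v5 n) (S.v6 n) x = 1 := S.normU n
    rw [nU] at aU
    rw [← aF]
    rw [g0] at p1
    rw [gL] at p2
    have : t / 2 = t / 2 * 1 := by ring
    rw [this, ← aU]
    linarith
  have hF := S.normF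
  change Tendsto (fun n => ∫ x in (0 : ℝ)..L, brE ρ₁ ρ₂ k₁ k₂ k₃ l (S.f1 n) (S.f2 n) (S.f3 n)
    (S.f4 n) (S.f5 n) (S.f6 n) x) atTop (nhds 0) at hF
  rw [Metric.tendsto_nhds]
  intro e he
  set t := a₀ * e with ht
  have ht0 : 0 < t := by positivity
  filter_upwards [hF.eventually_lt_const (show (0 : ℝ) < t * t by positivity)] with n hn
  have h0 := br_sq_nonneg hbeta.le (S.v6 n)
  rw [Real.dist_eq, sub_zero, abs_of_nonneg h0]
  have h1 := main n t ht0
  have h2 : t⁻¹ / 2 * (∫ x in (0 : ℝ)..L, brE ρ₁ ρ₂ k₁ k₂ k₃ l (S.f1 n) (S.f2 n) (S.f3 n) (S.f4 n)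
        (S.f5 n) (S.f6 n) x) < t⁻¹ / 2 * (t * t) := by gcongr
  have h3 : t⁻¹ / 2 * (t * t) = t / 2 := by field_simp
  rw [h3] at h2
  have h4 : a₀ * (∫ x in (0 : ℝ)..β, ‖S.v6 n x‖ ^ 2) < a₀ * e := by linarith
  exact lt_of_mul_lt_mul_left h4 ha0.le

/-- If the gradient is null then λq is null (on smaller intervals). -/
lemma br_bal1 {c d c' d' : ℝ} (h1 : c < c') (h2 : c' < d') (h3 : d' < d) {s : ℝ}
    {lam : ℕ → ℝ} {q q1 : ℕ → ℝ → ℂ}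
    (hT : BrTN c d (fun n x => brh c d x *
      (s * (q1 n x * star (q1 n x)) - ((lam n : ℂ) * q n x) * star ((lam n : ℂ) * q n x))))
    (hlq : BrBd c d (fun n x => (lam n : ℂ) * q n x)) (hq1 : BrNul c d q1) :
    BrNul c' d' (fun n x => (lam n : ℂ) * q n x) := by
  have hcd : c ≤ d := by linarith
  have t1 := ((hq1.hmul hcd (brh_cont c d)).mul hcd hq1.bd.star).cmul s
  have t := t1.add hcd (hT.cmul (-1))
  refine br_cut h1 h2 h3 ?_ hlq.1
  convert t using 3 with n x
  ring

lemma br_bal2 {c d c' d' : ℝ} (h1 : c < c') (h2 : c' < d') (h3 : d' < d) {s : ℝ} (hs : s ≠ 0)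
    {lam : ℕ → ℝ} {q q1 : ℕ → ℝ → ℂ}
    (hT : BrTN c d (fun n x => brh c d x *
      (s * (q1 n x * star (q1 n x)) - ((lam n : ℂ) * q n x) * star ((lam n : ℂ) * q n x))))
    (hlq : BrNul c d (fun n x => (lam n : ℂ) * q n x)) (hq1 : BrBd c d q1) :
    BrNul c' d' q1 := by
  have hcd : c ≤ d := by linarith
  have t1 := ((hlq.hmul hcd (brh_cont c d)).mul hcd hlq.bd.star)
  have t := (t1.add hcd hT).cmul ((s : ℂ)⁻¹)
  refine br_cut h1 h2 h3 ?_ hq1.1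
  have hs' : (s : ℂ) ≠ 0 := by exact_mod_cast hs
  convert t using 3 with n x
  field_simp
  ring

section
variable {ρ₁ ρ₂ k₁ k₂ k₃ l L β a₀ : ℝ}

lemma br_dataF (hrho1 : 0 < ρ₁) (hrho2 : 0 < ρ₂) (hk1 : 0 < k₁) (hk2 : 0 < k₂) (hk3 : 0 < k₃)
    (hL : 0 < L) {ℓ : ℕ} (S : BresseSetting ρ₁ ρ₂ k₁ k₂ k₃ l L β a₀ ℓ)
    {c d : ℝ} (hc : 0 < c) (hcd : c < d) (hd : d < L) :
    (BrNul c d S.f1 ∧ BrNul c d S.f3 ∧ BrNul c d S.f5) ∧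
    (BrNul c d S.f2 ∧ BrNul c d S.f4 ∧ BrNul c d S.f6) ∧
    (BrNul c d (fun n => deriv (S.f1 n)) ∧ BrNul c d (fun n => deriv (S.f3 n)) ∧
      BrNul c d (fun n => deriv (S.f5 n))) := by
  have hF := S.normF
  change Tendsto (fun n => ∫ x in (0 : ℝ)..L, brE ρ₁ ρ₂ k₁ k₂ k₃ l (S.f1 n) (S.f2 n) (S.f3 n)
    (S.f4 n) (S.f5 n) (S.f6 n) x) atTop (nhds 0) at hF
  have sub : Icc c d ⊆ Icc 0 L := Icc_subset_Icc hc.le hd.le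
  have sub' : Icc c d ⊆ Ioo 0 L := fun x hx => ⟨hc.trans_le hx.1, hx.2.trans_lt hd⟩
  have iF := fun n => (brE_int (ρ₁ := ρ₁) (ρ₂ := ρ₂) (k₁ := k₁) (k₂ := k₂) (k₃ := k₃) (l := l) hL
    (S.reg_f1 n) (S.reg_f2 n) (S.reg_f3 n) (S.reg_f4 n) (S.reg_f5 n) (S.reg_f6 n))
  have cmp := fun n x => brE_comp (l := l) hrho1 hrho2 hk1 hk2 hk3 (S.f1 n) (S.f2 n) (S.f3 n)
    (S.f4 n) (S.f5 n) (S.f6 n) x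
  have gen : ∀ {k : ℝ}, 0 < k → ∀ {Z : ℕ → ℝ → ℂ}, (∀ n, ContinuousOn (Z n) (Icc c d)) →
      (∀ n x, k * ‖Z n x‖ ^ 2 ≤ brE ρ₁ ρ₂ k₁ k₂ k₃ l (S.f1 n) (S.f2 n) (S.f3 n)
        (S.f4 n) (S.f5 n) (S.f6 n) x) → BrNul c d Z := by
    intro k hk Z hZ hle
    refine ⟨hZ, ?_⟩
    have h0 := hF.const_mul k⁻¹
    rw [mul_zero] at h0
    exact squeeze_zero (fun n => br_sq_nonneg hcd.le _) (fun n => br_comp hc hcd hd hk (iF n)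
      (fun x => (cmp n x).1) (hZ n) (hle n)) h0
  have cf1 := fun n => (S.reg_f1 n).continuousOn.mono sub
  have cf3 := fun n => (S.reg_f3 n).continuousOn.mono sub
  have cf5 := fun n => (S.reg_f5 n).continuousOn.mono sub
  have cd1 := fun n => (br_r3 (S.reg_f1 n)).mono sub'
  have cd3 := fun n => (br_r3 (S.reg_f3 n)).mono sub'
  have cd5 := fun n => (br_r3 (S.reg_f5 n)).mono sub'
  have n2 : BrNul c d S.f2 := gen hrho1 (fun n => (S.reg_f2 n).mono sub)
    (fun n x => (cmp n x).2.2.1)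
  have n4 : BrNul c d S.f4 := gen hrho2 (fun n => (S.reg_f4 n).mono sub)
    (fun n x => (cmp n x).2.2.2.2.1)
  have n6 : BrNul c d S.f6 := gen hrho1 (fun n => (S.reg_f6 n).mono sub)
    (fun n x => (cmp n x).2.2.2.2.2.2)
  have nd3 : BrNul c d (fun n => deriv (S.f3 n)) := gen hk2 cd3
    (fun n x => (cmp n x).2.2.2.1)
  have nA : BrNul c d (fun n x => deriv (S.f1 n) x + S.f3 n x + (l : ℂ) * S.f5 n x) := gen hk1
    (fun n => ((cd1 n).add (cf3 n)).add (continuousOn_const.mul (cf5 n)))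
    (fun n x => (cmp n x).2.1)
  have nC : BrNul c d (fun n x => deriv (S.f5 n) x - (l : ℂ) * S.f1 n x) := gen hk3
    (fun n => ((cd5 n).sub (continuousOn_const.mul (cf1 n))))
    (fun n x => (cmp n x).2.2.2.2.2.1)
  set K : ℝ := k₁⁻¹ + k₂⁻¹ + k₃⁻¹ with hK
  have gr := fun n (x : ℝ) (hx : x ∈ Icc 0 L) =>
    br_gron (l := l) (e := fun x => K * brE ρ₁ ρ₂ k₁ k₂ k₃ l (S.f1 n) (S.f2 n) (S.f3 n)
        (S.f4 n) (S.f5 n) (S.f6 n) x) hL (S.reg_f1 n) (S.reg_f3 n) (S.reg_f5 n)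
      (S.bc_zero n).2.2.2.2.2.2.1 (S.bc_zero n).2.2.2.2.2.2.2.1 (S.bc_zero n).2.2.2.2.2.2.2.2
      ((iF n).const_mul K) (fun x => mul_nonneg (by positivity) (cmp n x).1)
      (fun x => by
        have h1 := mul_le_mul_of_nonneg_left (cmp n x).2.1 (inv_pos.2 hk1).le
        have h2 := mul_le_mul_of_nonneg_left (cmp n x).2.2.2.1 (inv_pos.2 hk2).le
        have h3 := mul_le_mul_of_nonneg_left (cmp n x).2.2.2.2.2.1 (inv_pos.2 hk3).le
        rw [inv_mul_cancel_left₀ hk1.ne'] at h1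
        rw [inv_mul_cancel_left₀ hk2.ne'] at h2
        rw [inv_mul_cancel_left₀ hk3.ne'] at h3
        rw [hK]
        linarith) hx
  have unif : ∀ {Z : ℕ → ℝ → ℂ}, (∀ n, ContinuousOn (Z n) (Icc c d)) →
      (∀ n, ∀ x, ‖Z n x‖ ^ 2 ≤ ‖S.f1 n x‖ ^ 2 + ‖S.f3 n x‖ ^ 2 + ‖S.f5 n x‖ ^ 2) →
      BrNul c d Z := by
    intro Z hZ hle
    refine ⟨hZ, ?_⟩
    have h0 := hF.const_mul ((d - c) * (Real.exp (2 * L) * K))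
    rw [mul_zero] at h0
    refine squeeze_zero (fun n => br_sq_nonneg hcd.le _) (fun n => ?_) h0
    have := intervalIntegral.integral_mono_on hcd.le (br_sqi hcd.le (hZ n))
      (intervalIntegrable_const (c := (Real.exp (2 * L) * (K * ∫ x in (0 : ℝ)..L,
        brE ρ₁ ρ₂ k₁ k₂ k₃ l (S.f1 n) (S.f2 n) (S.f3 n) (S.f4 n) (S.f5 n) (S.f6 n) x))))
      (fun x hx => (hle n x).trans (by
        have := gr n x (sub hx)
        rwa [intervalIntegral.integral_const_mul] at this))
    refine this.trans (le_of_eq ?_)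
    rw [intervalIntegral.integral_const, smul_eq_mul]
    ring
  have n1 : BrNul c d S.f1 := unif cf1 (fun n x => by
    have i1 := sq_nonneg (‖S.f3 n x‖)
    have i2 := sq_nonneg (‖S.f5 n x‖)
    linarith)
  have n3 : BrNul c d S.f3 := unif cf3 (fun n x => by
    have i1 := sq_nonneg (‖S.f1 n x‖)
    have i2 := sq_nonneg (‖S.f5 n x‖)
    linarith)
  have n5 : BrNul c d S.f5 := unif cf5 (fun n x => by
    have i1 := sq_nonneg (‖S.f3 n x‖)
    have i2 := sq_nonneg (‖S.f1 n x‖)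
    linarith)
  refine ⟨⟨n1, n3, n5⟩, ⟨n2, n4, n6⟩, ?_, nd3, ?_⟩
  · refine ((nA.add hcd.le (n3.cmul hcd.le (-1))).add hcd.le (n5.cmul hcd.le (-l))).congr hcd.le ?_
    intro n x _; ring
  · refine (nC.add hcd.le (n1.cmul hcd.le l)).congr hcd.le ?_
    intro n x _; ring

lemma br_dataU (hrho1 : 0 < ρ₁) (hrho2 : 0 < ρ₂) (hk1 : 0 < k₁) (hk2 : 0 < k₂) (hk3 : 0 < k₃)
    (hL : 0 < L) (ha0 : 0 < a₀) (hbeta : 0 < β) (hbetaL : β < L)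
    (S : BresseSetting ρ₁ ρ₂ k₁ k₂ k₃ l L β a₀ 0)
    {c d : ℝ} (hc : 0 < c) (hcd : c < d) (hd : d < β) :
    BrNul c d S.v6 ∧ BrBd c d (fun n x => (S.lam n : ℂ) * S.v1 n x) ∧
    BrBd c d (fun n x => (S.lam n : ℂ) * S.v3 n x) ∧
    BrNul c d (fun n x => (S.lam n : ℂ) * S.v5 n x) ∧
    BrBd c d (fun n => deriv (S.v1 n)) ∧ BrBd c d (fun n => deriv (S.v3 n)) ∧
    BrBd c d (fun n => deriv (S.v5 n)) := by
  have hdL := hd.trans hbetaL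
  obtain ⟨⟨n1, n3, n5⟩, -, -⟩ := br_dataF hrho1 hrho2 hk1 hk2 hk3 hL S hc hcd hdL
  have sub : Icc c d ⊆ Icc 0 L := Icc_subset_Icc hc.le hdL.le
  have sub' : Icc c d ⊆ Ioo 0 L := fun x hx => ⟨hc.trans_le hx.1, hx.2.trans_lt hdL⟩
  have sub2 : ∀ x ∈ Icc c d, x ∈ Ioo (0 : ℝ) β ∪ Ioo β L :=
    fun x hx => Or.inl ⟨hc.trans_le hx.1, hx.2.trans_lt hd⟩
  have c1 := fun n => (S.reg_v1 n).of_le (m := 1) (by norm_num)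
  have c3 := fun n => (S.reg_v3 n).of_le (m := 1) (by norm_num)
  have iU := fun n => (brE_int (ρ₁ := ρ₁) (ρ₂ := ρ₂) (k₁ := k₁) (k₂ := k₂) (k₃ := k₃) (l := l) hL
      (c1 n) (S.reg_v2 n).continuousOn (c3 n) (S.reg_v4 n).continuousOn (S.reg_v5 n)
      (S.reg_v6 n).continuousOn)
  have cmp := fun n x => brE_comp (l := l) hrho1 hrho2 hk1 hk2 hk3 (S.v1 n) (S.v2 n) (S.v3 n)
    (S.v4 n) (S.v5 n) (S.v6 n) x
  have gen : ∀ {k : ℝ}, 0 < k → ∀ {Z : ℕ → ℝ → ℂ}, (∀ n, ContinuousOn (Z n) (Icc c d)) →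
      (∀ n x, k * ‖Z n x‖ ^ 2 ≤ brE ρ₁ ρ₂ k₁ k₂ k₃ l (S.v1 n) (S.v2 n) (S.v3 n)
        (S.v4 n) (S.v5 n) (S.v6 n) x) → BrBd c d Z := by
    intro k hk Z hZ hle
    refine ⟨hZ, k⁻¹ * 1, fun n => ?_⟩
    have nU : ∫ x in (0 : ℝ)..L, brE ρ₁ ρ₂ k₁ k₂ k₃ l (S.v1 n) (S.v2 n) (S.v3 n) (S.v4 n)
        (S.v5 n) (S.v6 n) x = 1 := S.normU n
    rw [← nU]
    exact br_comp hc hcd hdL hk (iU n) (fun x => (cmp n x).1) (hZ n) (hle n)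
  have cf1 := fun n => (c1 n).continuousOn.mono sub
  have cf3 := fun n => (c3 n).continuousOn.mono sub
  have cf5 := fun n => (S.reg_v5 n).continuousOn.mono sub
  have cd1 := fun n => (br_r3 (c1 n)).mono sub'
  have cd3 := fun n => (br_r3 (c3 n)).mono sub'
  have cd5 := fun n => (br_r3 (S.reg_v5 n)).mono sub'
  have b2 : BrBd c d S.v2 := gen hrho1 (fun n => (S.reg_v2 n).continuousOn.mono sub)
    (fun n x => (cmp n x).2.2.1)
  have b4 : BrBd c d S.v4 := gen hrho2 (fun n => (S.reg_v4 n).continuousOn.mono sub)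
    (fun n x => (cmp n x).2.2.2.2.1)
  have bd3 : BrBd c d (fun n => deriv (S.v3 n)) := gen hk2 cd3
    (fun n x => (cmp n x).2.2.2.1)
  have bA : BrBd c d (fun n x => deriv (S.v1 n) x + S.v3 n x + (l : ℂ) * S.v5 n x) := gen hk1
    (fun n => ((cd1 n).add (cf3 n)).add (continuousOn_const.mul (cf5 n)))
    (fun n x => (cmp n x).2.1)
  have bC : BrBd c d (fun n x => deriv (S.v5 n) x - (l : ℂ) * S.v1 n x) := gen hk3
    (fun n => ((cd5 n).sub (continuousOn_const.mul (cf1 n))))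
    (fun n x => (cmp n x).2.2.2.2.2.1)
  have n6 : BrNul c d S.v6 := by
    refine ⟨fun n => (S.reg_v6 n).continuousOn.mono sub, ?_⟩
    refine squeeze_zero (fun n => br_sq_nonneg hcd.le _) (fun n => ?_)
      (br_diss hrho1 hrho2 hk1 hk2 hk3 hL ha0 hbeta hbetaL S)
    exact intervalIntegral.integral_mono_interval hc.le hcd.le hd.le
      (Eventually.of_forall (fun x => by positivity))
      (br_sqi hbeta.le ((S.reg_v6 n).continuousOn.mono (Icc_subset_Icc_right hbetaL.le)))
  have alg : ∀ {L v w f : ℂ}, Complex.I * L * v - w = L ^ (-((0 : ℕ) : ℤ)) * f →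
      L * v = -Complex.I * (w + f) := by
    intro L v w f h
    simp only [Nat.cast_zero, neg_zero, zpow_zero, one_mul] at h
    linear_combination (-Complex.I) * h + (L * v) * Complex.I_mul_I
  have l1 : BrBd c d (fun n x => (S.lam n : ℂ) * S.v1 n x) :=
    ((b2.add hcd.le n1.bd).cmul hcd.le (-Complex.I)).congr hcd.le
      (fun n x hx => alg (S.eq1 n x (sub2 x hx)))
  have l3 : BrBd c d (fun n x => (S.lam n : ℂ) * S.v3 n x) :=
    ((b4.add hcd.le n3.bd).cmul hcd.le (-Complex.I)).congr hcd.le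
      (fun n x hx => alg (S.eq3 n x (sub2 x hx)))
  have l5 : BrNul c d (fun n x => (S.lam n : ℂ) * S.v5 n x) :=
    ((n6.add hcd.le n5).cmul hcd.le (-Complex.I)).congr hcd.le
      (fun n x hx => alg (S.eq5 n x (sub2 x hx)))
  have m1 := l1.small hcd.le S.lam_tendsto S.lam_ne
  have m3 := l3.small hcd.le S.lam_tendsto S.lam_ne
  have m5 := l5.bd.small hcd.le S.lam_tendsto S.lam_ne
  refine ⟨n6, l1, l3, l5, ?_, bd3, ?_⟩
  · refine ((bA.add hcd.le (m3.bd.cmul hcd.le (-1))).add hcd.le (m5.bd.cmul hcd.le (-l))).congr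
      hcd.le ?_
    intro n x _; ring
  · refine (bC.add hcd.le (m1.bd.cmul hcd.le l)).congr hcd.le ?_
    intro n x _; ring

lemma br_main (hrho1 : 0 < ρ₁) (hrho2 : 0 < ρ₂) (hk1 : 0 < k₁) (hk2 : 0 < k₂)
    (hl : 0 < l) (hL : 0 < L) (ha0 : 0 < a₀) (hbeta : 0 < β) (hbetaL : β < L)
    (S : BresseSetting ρ₁ ρ₂ k₁ k₂ k₁ l L β a₀ 0) (hs : k₁ / ρ₁ = k₂ / ρ₂) :
    ∀ c d : ℝ, 0 < c → c < d → d < β → BrNul c d (fun n => deriv (S.v3 n)) ∧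
      BrNul c d (fun n x => (S.lam n : ℂ) * S.v3 n x) := by
  set s : ℝ := k₁ / ρ₁ with hsdef
  have hs0 : s ≠ 0 := by positivity
  have hr1 : (ρ₁ : ℂ) ≠ 0 := by exact_mod_cast hrho1.ne'
  have hr2 : (ρ₂ : ℂ) ≠ 0 := by exact_mod_cast hrho2.ne'
  have hk : (k₁ : ℂ) = ρ₁ * s := by rw [hsdef]; push_cast; field_simp
  have hk' : (k₂ : ℂ) = ρ₂ * s := by rw [hs]; push_cast; field_simp
  have dF := fun (c d : ℝ) (hc : 0 < c) (hcd : c < d) (hd : d < β) =>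
    br_dataF hrho1 hrho2 hk1 hk2 hk1 hL S hc hcd (hd.trans hbetaL)
  have dU := fun (c d : ℝ) (hc : 0 < c) (hcd : c < d) (hd : d < β) =>
    br_dataU hrho1 hrho2 hk1 hk2 hk1 hL ha0 hbeta hbetaL S hc hcd hd
  have c1 := fun n => (S.reg_v1 n).of_le (m := 1) (by norm_num)
  have c3 := fun n => (S.reg_v3 n).of_le (m := 1) (by norm_num)
  have inL : ∀ x ∈ Ioo (0 : ℝ) β, x ∈ Ioo (0 : ℝ) L := fun x hx => ⟨hx.1, hx.2.trans hbetaL⟩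
  have D1 := fun n x hx => br_r1 (c1 n) (inL x hx)
  have D3 := fun n x hx => br_r1 (c3 n) (inL x hx)
  have D5 := fun n x hx => br_r1 (S.reg_v5 n) (inL x hx)
  have D11 := fun n x hx => br_r2 (S.reg_v1 n) (inL x hx)
  have D33 := fun n x hx => br_r2 (S.reg_v3 n) (inL x hx)
  have D55 : ∀ n, ∀ x ∈ Ioo (0 : ℝ) β, _ := fun n x hx => br_r2 (S.reg_v5_left n) hx
  have F1 := fun n x hx => br_r1 (S.reg_f1 n) (inL x hx)
  have F3 := fun n x hx => br_r1 (S.reg_f3 n) (inL x hx)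
  have F5 := fun n x hx => br_r1 (S.reg_f5 n) (inL x hx)
  -- the three wave equations
  have E6 : ∀ n, ∀ x ∈ Ioo (0 : ℝ) β, (S.lam n : ℂ) ^ 2 * S.v5 n x + s * deriv (deriv (S.v5 n)) x
      = ((2 * l * s : ℝ) : ℂ) * deriv (S.v1 n) x + (((l * s : ℂ) * S.v3 n x
          + (l * s * l : ℂ) * S.v5 n x) + ((a₀ / ρ₁ : ℂ) * S.v6 n x + (-1) * S.f6 n x))
        - Complex.I * S.lam n * S.f5 n x := by
    intro n x hx
    have h6 := S.eq6 n x (Or.inl hx)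
    have h5 := S.eq5 n x (Or.inl hx)
    rw [if_pos hx.2] at h6
    have hd : deriv (fun y => deriv (S.v5 n) y - (l : ℂ) * S.v1 n y) x =
      deriv (deriv (S.v5 n)) x - l * deriv (S.v1 n) x :=
      ((D55 n x hx).sub ((D1 n x hx).const_mul (l : ℂ))).deriv
    rw [hd] at h6
    simp only [Nat.cast_zero, neg_zero, zpow_zero, one_mul, mul_one] at h5 h6
    apply mul_left_cancel₀ hr1
    push_cast
    rw [hk] at h6
    field_simp
    linear_combination (-1 : ℂ) * h6 - (Complex.I * S.lam n * ρ₁) * h5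
      + (S.lam n : ℂ) ^ 2 * ρ₁ * S.v5 n x * Complex.I_mul_I
  have E2 : ∀ n, ∀ x ∈ Ioo (0 : ℝ) β, (S.lam n : ℂ) ^ 2 * S.v1 n x + s * deriv (deriv (S.v1 n)) x
      = ((-s : ℝ) : ℂ) * deriv (S.v3 n) x + (((-2 * s * l : ℂ) * deriv (S.v5 n) x
          + (s * l * l : ℂ) * S.v1 n x) + (-1) * S.f2 n x)
        - Complex.I * S.lam n * S.f1 n x := by
    intro n x hx
    have h2 := S.eq2 n x (Or.inl hx)
    have h1 := S.eq1 n x (Or.inl hx)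
    have hd : deriv (fun y => deriv (S.v1 n) y + S.v3 n y + (l : ℂ) * S.v5 n y) x =
      deriv (deriv (S.v1 n)) x + deriv (S.v3 n) x + l * deriv (S.v5 n) x :=
      (((D11 n x hx).add (D3 n x hx)).add ((D5 n x hx).const_mul (l : ℂ))).deriv
    rw [hd] at h2
    simp only [Nat.cast_zero, neg_zero, zpow_zero, one_mul, mul_one] at h1 h2
    apply mul_left_cancel₀ hr1
    push_cast
    rw [hk] at h2
    linear_combination (-1 : ℂ) * h2 - (Complex.I * S.lam n * ρ₁) * h1
      + (S.lam n : ℂ) ^ 2 * ρ₁ * S.v1 n x * Complex.I_mul_I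
  have E4 : ∀ n, ∀ x ∈ Ioo (0 : ℝ) β, (S.lam n : ℂ) ^ 2 * S.v3 n x + s * deriv (deriv (S.v3 n)) x
      = ((k₁ / ρ₂ : ℂ) * ((deriv (S.v1 n) x + S.v3 n x) + l * S.v5 n x) + (-1) * S.f4 n x)
        - Complex.I * S.lam n * S.f3 n x := by
    intro n x hx
    have h4 := S.eq4 n x (Or.inl hx)
    have h3 := S.eq3 n x (Or.inl hx)
    simp only [Nat.cast_zero, neg_zero, zpow_zero, one_mul, mul_one] at h3 h4
    apply mul_left_cancel₀ hr2
    rw [hk'] at h4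
    field_simp
    linear_combination (-1 : ℂ) * h4 - (Complex.I * S.lam n * ρ₂) * h3
      + (S.lam n : ℂ) ^ 2 * ρ₂ * S.v3 n x * Complex.I_mul_I
  have hsub : ∀ {c d : ℝ}, 0 < c → d < β → ∀ x ∈ Icc c d, x ∈ Ioo (0 : ℝ) β :=
    fun hc hd x hx => ⟨hc.trans_le hx.1, hx.2.trans_lt hd⟩
  have hlt := S.lam_tendsto
  have hne := S.lam_ne
  -- null / bounded right-hand sides
  have R6 : ∀ c d : ℝ, 0 < c → c < d → d < β → BrNul c d (fun n x => (((l * s : ℂ) * S.v3 n x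
          + (l * s * l : ℂ) * S.v5 n x) + ((a₀ / ρ₁ : ℂ) * S.v6 n x + (-1) * S.f6 n x))) := by
    intro c d hc hcd hd
    obtain ⟨n6, l1, l3, l5, b1, b3, b5⟩ := dU c d hc hcd hd
    obtain ⟨⟨f1, f3, f5⟩, ⟨f2, f4, f6⟩, -⟩ := dF c d hc hcd hd
    have m3 := l3.small hcd.le hlt hne
    have m5 := l5.bd.small hcd.le hlt hne
    exact ((m3.cmul hcd.le _).add hcd.le (m5.cmul hcd.le _)).add hcd.le
      ((n6.cmul hcd.le _).add hcd.le (f6.cmul hcd.le _))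
  -- Step 2
  have N5 : ∀ c d : ℝ, 0 < c → c < d → d < β → BrNul c d (fun n => deriv (S.v5 n)) := by
    intro c' d' hc' hcd' hd'
    obtain ⟨c, hc, hcc⟩ := exists_between hc'
    obtain ⟨d, hdd, hd⟩ := exists_between hd'
    have hcd : c < d := by linarith
    obtain ⟨n6, l1, l3, l5, b1, b3, b5⟩ := dU c d hc hcd hd
    obtain ⟨⟨f1, f3, f5⟩, -, -⟩ := dF c d hc hcd hd
    have sub := hsub hc hd
    have T := br_balance hcd hlt hne (fun n x hx => D5 n x (sub x hx))
      (fun n x hx => D55 n x (sub x hx)) (fun n x hx => E6 n x (sub x hx)) l5.bd b5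
      ((b1.cmul hcd.le _).add hcd.le (R6 c d hc hcd hd).bd) f5
    exact br_bal2 hcc hcd' hdd hs0 T l5 b5
  have R2 : ∀ c d : ℝ, 0 < c → c < d → d < β → BrNul c d (fun n x =>
      (((-2 * s * l : ℂ) * deriv (S.v5 n) x
          + (s * l * l : ℂ) * S.v1 n x) + (-1) * S.f2 n x)) := by
    intro c d hc hcd hd
    obtain ⟨n6, l1, l3, l5, b1, b3, b5⟩ := dU c d hc hcd hd
    obtain ⟨⟨f1, f3, f5⟩, ⟨f2, f4, f6⟩, -⟩ := dF c d hc hcd hd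
    have m1 := l1.small hcd.le hlt hne
    exact (((N5 c d hc hcd hd).cmul hcd.le _).add hcd.le (m1.cmul hcd.le _)).add hcd.le
      (f2.cmul hcd.le _)
  have Q4 : ∀ c d : ℝ, 0 < c → c < d → d < β → BrBd c d (fun n x =>
      ((k₁ / ρ₂ : ℂ) * ((deriv (S.v1 n) x + S.v3 n x) + l * S.v5 n x) + (-1) * S.f4 n x)) := by
    intro c d hc hcd hd
    obtain ⟨n6, l1, l3, l5, b1, b3, b5⟩ := dU c d hc hcd hd
    obtain ⟨⟨f1, f3, f5⟩, ⟨f2, f4, f6⟩, -⟩ := dF c d hc hcd hd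
    have m3 := l3.small hcd.le hlt hne
    have m5 := l5.bd.small hcd.le hlt hne
    exact (((b1.add hcd.le m3.bd).add hcd.le (m5.bd.cmul hcd.le _)).cmul hcd.le _).add hcd.le
      (f4.bd.cmul hcd.le _)
  -- Step 3
  have N1 : ∀ c d : ℝ, 0 < c → c < d → d < β → BrNul c d (fun n => deriv (S.v1 n)) := by
    intro c' d' hc' hcd' hd'
    obtain ⟨c, hc, hcc⟩ := exists_between hc'
    obtain ⟨d, hdd, hd⟩ := exists_between hd'
    have hcd : c < d := by linarith
    obtain ⟨n6, l1, l3, l5, b1, b3, b5⟩ := dU c d hc hcd hd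
    obtain ⟨⟨f1, f3, f5⟩, -, g1, g3, g5⟩ := dF c d hc hcd hd
    have sub := hsub hc hd
    have T := br_transfer hcd (κ := 2 * l * s) (by positivity) (fun n x hx => D5 n x (sub x hx))
      (fun n x hx => D55 n x (sub x hx)) (fun n x hx => D1 n x (sub x hx))
      (fun n x hx => D11 n x (sub x hx)) (fun n x hx => F5 n x (sub x hx))
      (fun n x hx => F1 n x (sub x hx)) (fun n x hx => E6 n x (sub x hx))
      (fun n x hx => E2 n x (sub x hx)) l5 (N5 c d hc hcd hd) l1 b1
      ((b3.cmul hcd.le _).add hcd.le (R2 c d hc hcd hd).bd) (R6 c d hc hcd hd) f5 g5 f1 g1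
    exact br_cut hcc hcd' hdd T b1.1
  -- Step 4
  have L1 : ∀ c d : ℝ, 0 < c → c < d → d < β →
      BrNul c d (fun n x => (S.lam n : ℂ) * S.v1 n x) := by
    intro c' d' hc' hcd' hd'
    obtain ⟨c, hc, hcc⟩ := exists_between hc'
    obtain ⟨d, hdd, hd⟩ := exists_between hd'
    have hcd : c < d := by linarith
    obtain ⟨n6, l1, l3, l5, b1, b3, b5⟩ := dU c d hc hcd hd
    obtain ⟨⟨f1, f3, f5⟩, -, -⟩ := dF c d hc hcd hd
    have sub := hsub hc hd
    have T := br_balance hcd hlt hne (fun n x hx => D1 n x (sub x hx))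
      (fun n x hx => D11 n x (sub x hx)) (fun n x hx => E2 n x (sub x hx)) l1 b1
      ((b3.cmul hcd.le _).add hcd.le (R2 c d hc hcd hd).bd) f1
    exact br_bal1 hcc hcd' hdd T l1 (N1 c d hc hcd hd)
  -- Step 5
  have N3 : ∀ c d : ℝ, 0 < c → c < d → d < β → BrNul c d (fun n => deriv (S.v3 n)) := by
    intro c' d' hc' hcd' hd'
    obtain ⟨c, hc, hcc⟩ := exists_between hc'
    obtain ⟨d, hdd, hd⟩ := exists_between hd'
    have hcd : c < d := by linarith
    obtain ⟨n6, l1, l3, l5, b1, b3, b5⟩ := dU c d hc hcd hd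
    obtain ⟨⟨f1, f3, f5⟩, -, g1, g3, g5⟩ := dF c d hc hcd hd
    have sub := hsub hc hd
    have T := br_transfer hcd (κ := -s) (neg_ne_zero.2 hs0) (fun n x hx => D1 n x (sub x hx))
      (fun n x hx => D11 n x (sub x hx)) (fun n x hx => D3 n x (sub x hx))
      (fun n x hx => D33 n x (sub x hx)) (fun n x hx => F1 n x (sub x hx))
      (fun n x hx => F3 n x (sub x hx)) (fun n x hx => E2 n x (sub x hx))
      (fun n x hx => E4 n x (sub x hx)) (L1 c d hc hcd hd) (N1 c d hc hcd hd) l3 b3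
      (Q4 c d hc hcd hd) (R2 c d hc hcd hd) f1 g1 f3 g3
    exact br_cut hcc hcd' hdd T b3.1
  -- Step 6
  intro c' d' hc' hcd' hd'
  refine ⟨N3 c' d' hc' hcd' hd', ?_⟩
  obtain ⟨c, hc, hcc⟩ := exists_between hc'
  obtain ⟨d, hdd, hd⟩ := exists_between hd'
  have hcd : c < d := by linarith
  obtain ⟨n6, l1, l3, l5, b1, b3, b5⟩ := dU c d hc hcd hd
  obtain ⟨⟨f1, f3, f5⟩, -, -⟩ := dF c d hc hcd hd
  have sub := hsub hc hd
  have T := br_balance hcd hlt hne (fun n x hx => D3 n x (sub x hx))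
    (fun n x hx => D33 n x (sub x hx)) (fun n x hx => E4 n x (sub x hx)) l3 b3
    (Q4 c d hc hcd hd) f3
  exact br_bal1 hcc hcd' hdd T l3 (N3 c d hc hcd hd)

end

theorem bresse_lemma6_H1 (ρ₁ ρ₂ k₁ k₂ k₃ l L β a₀ : ℝ) (ℓ : ℕ)
    (hrho1 : 0 < ρ₁) (hrho2 : 0 < ρ₂) (hk1 : 0 < k₁) (hk2 : 0 < k₂) (hk3 : 0 < k₃)
    (hl : 0 < l) (hL : 0 < L) (ha0 : 0 < a₀) (hbeta : 0 < β) (hbetaL : β < L)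
    (S : BresseSetting ρ₁ ρ₂ k₁ k₂ k₃ l L β a₀ ℓ)
    (hH : k₁ / ρ₁ = k₂ / ρ₂ ∧ k₁ = k₃ ∧ ℓ = 0) :
    ∀ ε : ℝ, 0 < ε → ε < β / 12 →
    Tendsto (fun n => ∫ x in (3 * ε)..(β - 3 * ε), ‖deriv (S.v3 n) x‖ ^ 2) atTop (nhds 0) ∧
    Tendsto (fun n => (S.lam n) ^ 2 * ∫ x in (4 * ε)..(β - 4 * ε), ‖S.v3 n x‖ ^ 2)
      atTop (nhds 0) := by
  obtain ⟨hs, rfl, rfl⟩ := hH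
  intro ε hε hε2
  have M := br_main hrho1 hrho2 hk1 hk2 hl hL ha0 hbeta hbetaL S hs
  refine ⟨(M (3 * ε) (β - 3 * ε) (by linarith) (by linarith) (by linarith)).1.2, ?_⟩
  refine (M (4 * ε) (β - 4 * ε) (by linarith) (by linarith) (by linarith)).2.2.congr (fun n => ?_)
  rw [← intervalIntegral.integral_const_mul]
  congr 1; ext x
  rw [norm_mul, mul_pow]; simp
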